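/- arXiv:1407.3573 — 4 statements merged into one kernel-verified Lean document; each statement's English description precedes it below -/
import Mathlib

section
/- (Siegel mean value theorem) Let d ≥ 2 and let f be a bounded, compactly supported, Riemann-integrable function on ℝ^d. Then the Siegel transform f̂ belongs to L¹(X_d, μ) and ∫_{ℝ^d} f(v) dv = ∫_{X_d} f̂ dμ, where the left-hand integral is with respect to Lebesgue measure on ℝ^d. -/
open MeasureTheory Matrix Filter Topology

noncomputable section

/-- `SL_d(ℝ)`. -/
abbrev SLR (d : ℕ) := Matrix.SpecialLinearGroup (Fin d) ℝ

instance (d : ℕ) : TopologicalSpace (SLR d) :=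
  show TopologicalSpace {A : Matrix (Fin d) (Fin d) ℝ // A.det = 1} from inferInstance

/-- The image of `SL_d(ℤ)` in `SL_d(ℝ)`. -/
def GammaSL (d : ℕ) : Subgroup (SLR d) :=
  (Matrix.SpecialLinearGroup.map (n := Fin d) (Int.castRingHom ℝ)).range

/-- The space of unimodular lattices `X_d = SL_d(ℝ)/SL_d(ℤ)`. -/
abbrev XSp (d : ℕ) := SLR d ⧸ GammaSL d

instance (d : ℕ) : MeasurableSpace (XSp d) := borel _

/-- The Siegel transform of `f`, as a function of a matrix `M`: the sum of `f` over
the nonzero points of the lattice `M ℤ^d`. -/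
def siegelM {d : ℕ} (f : (Fin d → ℝ) → ℝ) (M : Matrix (Fin d) (Fin d) ℝ) : ℝ :=
  ∑' p : {p : Fin d → ℤ // p ≠ 0}, f (M.mulVec fun i => ((p : Fin d → ℤ) i : ℝ))

/-- The Siegel transform of `f` as a function on the space of lattices `X_d`. -/
def siegelX {d : ℕ} (f : (Fin d → ℝ) → ℝ) (x : XSp d) : ℝ :=
  siegelM f ((Quotient.out x : SLR d) : Matrix (Fin d) (Fin d) ℝ)

instance isTopologicalGroup_SLR (d : ℕ) : IsTopologicalGroup (SLR d) :=
  Matrix.SpecialLinearGroup.topologicalGroup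

theorem continuous_coe_SLR (d : ℕ) :
    Continuous (fun g : SLR d => (g : Matrix (Fin d) (Fin d) ℝ)) :=
  continuous_subtype_val

instance polishSpace_SLR (d : ℕ) : PolishSpace (SLR d) := by
  have : PolishSpace (Matrix (Fin d) (Fin d) ℝ) :=
    inferInstanceAs (PolishSpace (Fin d → Fin d → ℝ))
  exact IsClosed.polishSpace (s := {A : Matrix (Fin d) (Fin d) ℝ | A.det = 1})
    (isClosed_eq continuous_id.matrix_det continuous_const)

theorem isClosed_GammaSL (d : ℕ) : IsClosed (GammaSL d : Set (SLR d)) := by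
  have h : (GammaSL d : Set (SLR d)) =
      ⋂ i, ⋂ j, (fun g : SLR d => (g : Matrix (Fin d) (Fin d) ℝ) i j) ⁻¹'
        Set.range (Int.cast : ℤ → ℝ) := by
    ext g
    simp only [GammaSL, MonoidHom.coe_range, Set.mem_range, Set.mem_iInter, Set.mem_preimage]
    constructor
    · rintro ⟨γ, rfl⟩ i j
      exact ⟨γ.1 i j, by simp⟩
    · intro h
      choose A hA using h
      have hA' : (Matrix.of A).map (Int.cast : ℤ → ℝ) = (g : Matrix (Fin d) (Fin d) ℝ) := by
        ext i j; simp [hA]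
      refine ⟨⟨Matrix.of A, ?_⟩, ?_⟩
      · have := Matrix.SpecialLinearGroup.det_coe g
        rw [← hA'] at this
        have h2 := (Int.castRingHom ℝ).map_det (Matrix.of A)
        simp only [RingHom.mapMatrix_apply, Int.coe_castRingHom] at h2
        rw [this] at h2
        exact_mod_cast h2
      · exact Matrix.SpecialLinearGroup.ext _ _ fun i j => hA i j
  rw [h]
  refine isClosed_iInter fun i => isClosed_iInter fun j => ?_
  exact Int.isClosedEmbedding_coe_real.isClosed_range.preimage
    ((continuous_coe_SLR d).matrix_elem i j)

instance t1Space_XSp (d : ℕ) : T1Space (XSp d) :=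
  haveI := isClosed_GammaSL d
  inferInstance

instance secondCountable_XSp (d : ℕ) : SecondCountableTopology (XSp d) := inferInstance

instance borelSpace_XSp (d : ℕ) : BorelSpace (XSp d) := ⟨rfl⟩

instance measurableSpace_SLR (d : ℕ) : MeasurableSpace (SLR d) := borel _

instance borelSpace_SLR (d : ℕ) : BorelSpace (SLR d) := ⟨rfl⟩

theorem measurable_of_comp_mk {d : ℕ} {β : Type*} [MeasurableSpace β] {F : XSp d → β}
    (hF : Measurable fun g : SLR d => F (QuotientGroup.mk g)) : Measurable F := by
  intro s hs
  have h := Continuous.map_borel_eq (f := (QuotientGroup.mk : SLR d → XSp d))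
    QuotientGroup.continuous_mk QuotientGroup.mk_surjective
  change MeasurableSet[borel (XSp d)] _
  rw [← h]
  exact hF hs

/-- The sum of the Dirac masses at the nonzero points of `g ℤ^d`. -/
def latticeMeasure {d : ℕ} (g : SLR d) : Measure (Fin d → ℝ) :=
  Measure.sum fun p : {p : Fin d → ℤ // p ≠ 0} =>
    Measure.dirac ((g : Matrix (Fin d) (Fin d) ℝ).mulVec fun i => ((p : Fin d → ℤ) i : ℝ))

theorem measurable_mulVec_SLR {d : ℕ} (v : Fin d → ℝ) :
    Measurable fun g : SLR d => (g : Matrix (Fin d) (Fin d) ℝ).mulVec v :=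
  ((continuous_coe_SLR d).matrix_mulVec continuous_const).measurable

theorem measurable_latticeMeasure (d : ℕ) : Measurable (latticeMeasure (d := d)) := by
  refine Measure.measurable_of_measurable_coe _ fun s hs => ?_
  simp only [latticeMeasure, Measure.sum_apply _ hs]
  refine Measurable.tsum fun p => ?_
  exact (Measure.measurable_coe hs).comp (Measure.measurable_dirac.comp (measurable_mulVec_SLR _))

theorem latticeMeasure_mul_map {d : ℕ} (g : SLR d) (γ : SpecialLinearGroup (Fin d) ℤ) :
    latticeMeasure (g * Matrix.SpecialLinearGroup.map (Int.castRingHom ℝ) γ) =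
      latticeMeasure g := by
  let e : {p : Fin d → ℤ // p ≠ 0} ≃ {p : Fin d → ℤ // p ≠ 0} :=
    (Matrix.SpecialLinearGroup.toLin' γ).toEquiv.subtypeEquiv fun p => by simp
  ext s hs
  simp only [latticeMeasure, Measure.sum_apply _ hs]
  rw [← e.tsum_eq fun q => Measure.dirac
    ((g : Matrix (Fin d) (Fin d) ℝ).mulVec fun i => ((q : Fin d → ℤ) i : ℝ)) s]
  refine tsum_congr fun p => ?_
  congr 2
  rw [Matrix.SpecialLinearGroup.coe_mul, ← Matrix.mulVec_mulVec]
  congr 1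
  have he : ((e p : {p : Fin d → ℤ // p ≠ 0}) : Fin d → ℤ) =
    (γ : Matrix (Fin d) (Fin d) ℤ).mulVec (p : Fin d → ℤ) := rfl
  ext i
  simp [he, Matrix.mulVec, dotProduct]

/-- The sum of the Dirac masses at the nonzero points of a lattice. -/
def latticeMeasureX {d : ℕ} (x : XSp d) : Measure (Fin d → ℝ) :=
  latticeMeasure (Quotient.out x : SLR d)

theorem latticeMeasureX_mk {d : ℕ} (g : SLR d) :
    latticeMeasureX (QuotientGroup.mk g : XSp d) = latticeMeasure g := by
  obtain ⟨⟨_, γ, rfl⟩, h⟩ := QuotientGroup.mk_out_eq_mul (GammaSL d) g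
  change latticeMeasure (Quotient.out (QuotientGroup.mk g : XSp d)) = _
  rw [h]
  exact latticeMeasure_mul_map g γ

theorem measurable_latticeMeasureX (d : ℕ) : Measurable (latticeMeasureX (d := d)) :=
  measurable_of_comp_mk (by simpa only [latticeMeasureX_mk] using measurable_latticeMeasure d)

theorem lintegral_latticeMeasure {d : ℕ} (g : SLR d) {F : (Fin d → ℝ) → ENNReal} :
    ∫⁻ v, F v ∂latticeMeasure g =
      ∑' p : {p : Fin d → ℤ // p ≠ 0},
        F ((g : Matrix (Fin d) (Fin d) ℝ).mulVec fun i => ((p : Fin d → ℤ) i : ℝ)) := by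
  simp [latticeMeasure, lintegral_sum_measure]

theorem lintegral_latticeMeasureX_smul {d : ℕ} (h : SLR d) (x : XSp d)
    {F : (Fin d → ℝ) → ENNReal} :
    ∫⁻ v, F v ∂latticeMeasureX (h • x) =
      ∫⁻ v, F ((h : Matrix (Fin d) (Fin d) ℝ).mulVec v) ∂latticeMeasureX x := by
  induction x using QuotientGroup.induction_on with
  | H g =>
    have hg : h • (QuotientGroup.mk g : XSp d) = QuotientGroup.mk (h * g) := rfl
    rw [hg, latticeMeasureX_mk, latticeMeasureX_mk,
      lintegral_latticeMeasure, lintegral_latticeMeasure]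
    simp [Matrix.mulVec_mulVec]

/-- The intensity measure of the random set of nonzero points of a `μ`-random lattice. -/
def siegelMeasure {d : ℕ} (μ : Measure (XSp d)) : Measure (Fin d → ℝ) :=
  μ.bind latticeMeasureX

theorem lintegral_siegelMeasure {d : ℕ} (μ : Measure (XSp d)) {F : (Fin d → ℝ) → ENNReal}
    (hF : AEMeasurable F (siegelMeasure μ)) :
    ∫⁻ v, F v ∂siegelMeasure μ = ∫⁻ x, ∫⁻ v, F v ∂latticeMeasureX x ∂μ :=
  Measure.lintegral_bind (measurable_latticeMeasureX d).aemeasurable hF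

theorem measurable_mulVec {d : ℕ} (A : Matrix (Fin d) (Fin d) ℝ) :
    Measurable fun v : Fin d → ℝ => A.mulVec v :=
  (Continuous.matrix_mulVec continuous_const continuous_id).measurable

theorem siegelMeasure_preimage {d : ℕ} {μ : Measure (XSp d)}
    (hμ : ∀ h : SLR d, MeasurePreserving (fun x : XSp d => h • x) μ μ) (h : SLR d)
    {s : Set (Fin d → ℝ)} (hs : MeasurableSet s) :
    siegelMeasure μ ((fun v => (h : Matrix (Fin d) (Fin d) ℝ).mulVec v) ⁻¹' s) =
      siegelMeasure μ s := by
  have hs' := measurable_mulVec (h : Matrix (Fin d) (Fin d) ℝ) hs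
  rw [← lintegral_indicator_one hs', ← lintegral_indicator_one hs,
    lintegral_siegelMeasure μ (measurable_one.indicator hs').aemeasurable,
    lintegral_siegelMeasure μ (measurable_one.indicator hs).aemeasurable]
  have hF : Measurable fun x : XSp d => ∫⁻ v, s.indicator 1 v ∂latticeMeasureX x :=
    (Measure.measurable_lintegral (measurable_one.indicator hs)).comp
      (measurable_latticeMeasureX d)
  rw [← (hμ h).lintegral_comp hF]
  refine lintegral_congr fun x => ?_
  rw [lintegral_latticeMeasureX_smul]
  rfl

theorem volume_preimage_mulVec {d : ℕ} (h : SLR d) (s : Set (Fin d → ℝ)) :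
    volume ((fun v => (h : Matrix (Fin d) (Fin d) ℝ).mulVec v) ⁻¹' s) = volume s := by
  have hdet : LinearMap.det (Matrix.toLin' (h : Matrix (Fin d) (Fin d) ℝ)) = 1 := by
    rw [LinearMap.det_toLin', Matrix.SpecialLinearGroup.det_coe]
  have hp := Measure.addHaar_preimage_linearMap volume
    (f := Matrix.toLin' (h : Matrix (Fin d) (Fin d) ℝ)) (by simp [hdet]) s
  rw [hdet] at hp
  simp only [inv_one, abs_one, ENNReal.ofReal_one, one_mul] at hp
  exact hp

theorem mulVec_inv_mulVec {d : ℕ} (h : SLR d) (v : Fin d → ℝ) :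
    ((h⁻¹ : SLR d) : Matrix (Fin d) (Fin d) ℝ).mulVec
      ((h : Matrix (Fin d) (Fin d) ℝ).mulVec v) = v := by
  rw [Matrix.mulVec_mulVec, ← Matrix.SpecialLinearGroup.coe_mul]
  simp

theorem siegelMeasure_singleton_zero {d : ℕ} (μ : Measure (XSp d)) :
    siegelMeasure μ {0} = 0 := by
  have h0 : MeasurableSet ({0} : Set (Fin d → ℝ)) := measurableSet_singleton 0
  rw [← lintegral_indicator_one h0,
    lintegral_siegelMeasure μ (measurable_one.indicator h0).aemeasurable]
  refine (lintegral_congr fun x => ?_).trans lintegral_zero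
  rw [latticeMeasureX, lintegral_latticeMeasure]
  refine ENNReal.tsum_eq_zero.2 fun p => ?_
  refine Set.indicator_of_notMem (fun h => p.2 ?_) _
  have h1 := mulVec_inv_mulVec (Quotient.out x : SLR d) fun i => ((p : Fin d → ℤ) i : ℝ)
  rw [Set.mem_singleton_iff.1 h, Matrix.mulVec_zero] at h1
  ext i
  simpa using (congrFun h1 i).symm

/-- `SL_d(ℝ)` moves every nonzero vector into a given open half-space. -/
theorem exists_SLR_mulVec_pos {m : ℕ} (hm : 1 ≤ m) {v : Fin (m + 1) → ℝ} (hv : v ≠ 0) :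
    ∃ h : SLR (m + 1), 0 < (h : Matrix (Fin (m + 1)) (Fin (m + 1)) ℝ).mulVec v 0 := by
  have key : ∀ w : Fin (m + 1) → ℝ, (∃ i, i ≠ 0 ∧ w i ≠ 0) →
      ∃ h : SLR (m + 1), 0 < (h : Matrix (Fin (m + 1)) (Fin (m + 1)) ℝ).mulVec w 0 := by
    rintro w ⟨i, hi, hwi⟩
    refine ⟨⟨Matrix.transvection 0 i ((1 - w 0) / w i),
      Matrix.det_transvection_of_ne _ _ hi.symm _⟩, ?_⟩
    have : (Matrix.transvection 0 i ((1 - w 0) / w i)).mulVec w 0 = 1 := by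
      simp [Matrix.transvection, Matrix.add_mulVec, Matrix.single_mulVec, hwi]
    exact one_pos.trans_eq this.symm
  by_cases h : ∃ i, i ≠ 0 ∧ v i ≠ 0
  · exact key v h
  push Not at h
  have hv0 : v 0 ≠ 0 := fun h0 => hv <| by
    ext i
    by_cases hi : i = 0
    · simp [hi, h0]
    · simp [h i hi]
  have h1 : Fin.last m ≠ 0 := by
    simp [Fin.ext_iff]; omega
  let t : SLR (m + 1) := ⟨Matrix.transvection (Fin.last m) 0 1,
      Matrix.det_transvection_of_ne _ _ h1 _⟩
  obtain ⟨k, hk⟩ := key ((t : Matrix (Fin (m + 1)) (Fin (m + 1)) ℝ).mulVec v)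
    ⟨Fin.last m, h1, by
      simp [t, Matrix.transvection, Matrix.add_mulVec, Matrix.single_mulVec, h _ h1, hv0]⟩
  exact ⟨k * t, by rwa [Matrix.SpecialLinearGroup.coe_mul, ← Matrix.mulVec_mulVec]⟩

theorem siegelMeasure_eq_volume_of_halfspace {m : ℕ} (hm : 1 ≤ m) {μ : Measure (XSp (m + 1))}
    (hμ : ∀ h : SLR (m + 1), MeasurePreserving (fun x : XSp (m + 1) => h • x) μ μ)
    (hU : ∀ s : Set (Fin (m + 1) → ℝ), MeasurableSet s → s ⊆ {v | 0 < v 0} →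
      siegelMeasure μ s = volume s) :
    siegelMeasure μ = volume := by
  let U : SLR (m + 1) → Set (Fin (m + 1) → ℝ) := fun h =>
    {v | 0 < (h : Matrix (Fin (m + 1)) (Fin (m + 1)) ℝ).mulVec v 0}
  have hUo : ∀ h, IsOpen (U h) := fun h =>
    isOpen_lt continuous_const
      ((continuous_apply 0).comp (Continuous.matrix_mulVec continuous_const continuous_id))
  obtain ⟨T, hT, hTU⟩ := TopologicalSpace.isOpen_iUnion_countable U hUo
  have hr : ∀ h ∈ T, (siegelMeasure μ).restrict (U h) =
      (volume : Measure (Fin (m + 1) → ℝ)).restrict (U h) := by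
    intro h _
    ext s hs
    rw [Measure.restrict_apply hs, Measure.restrict_apply hs]
    have hi := measurable_mulVec ((h⁻¹ : SLR (m + 1)) : Matrix (Fin (m + 1)) (Fin (m + 1)) ℝ)
      (hs.inter (hUo h).measurableSet)
    rw [← siegelMeasure_preimage hμ h⁻¹ (hs.inter (hUo h).measurableSet),
      ← volume_preimage_mulVec h⁻¹ (s ∩ U h)]
    refine hU _ hi fun v hv => ?_
    have h2 := hv.2
    have h3 := mulVec_inv_mulVec h⁻¹ v
    rw [inv_inv] at h3
    simpa only [U, Set.mem_ofPred_eq, h3] using h2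
  have hun : (⋃ h ∈ T, U h) = {0}ᶜ := by
    rw [hTU]
    ext v
    simp only [Set.mem_iUnion, Set.mem_compl_iff, Set.mem_singleton_iff]
    constructor
    · rintro ⟨h, hv⟩ rfl
      simp [U] at hv
    · exact fun hv => exists_SLR_mulVec_pos hm hv
  have hc := (Measure.restrict_biUnion_congr hT).2 hr
  rw [hun] at hc
  have h1 : (siegelMeasure μ).restrict {0}ᶜ = siegelMeasure μ :=
    Measure.restrict_eq_self_of_ae_mem
      (by rw [ae_iff]; simpa using siegelMeasure_singleton_zero μ)
  have h2 : (volume : Measure (Fin (m + 1) → ℝ)).restrict {0}ᶜ = volume :=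
    Measure.restrict_eq_self_of_ae_mem (by rw [ae_iff]; simp)
  rw [← h1, hc, h2]

theorem isClosedEmbedding_intCast_pi (d : ℕ) :
    IsClosedEmbedding fun (p : Fin d → ℤ) (i : Fin d) => (p i : ℝ) := by
  refine ⟨IsEmbedding.piMap fun _ => Int.isClosedEmbedding_coe_real.isEmbedding, ?_⟩
  have := Set.range_piMap (fun (_ : Fin d) (n : ℤ) => (n : ℝ))
  change IsClosed (Set.range (Pi.map fun (_ : Fin d) (n : ℤ) => (n : ℝ)))
  rw [this]
  exact isClosed_set_pi fun _ _ => Int.isClosedEmbedding_coe_real.isClosed_range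

theorem finite_lattice_support {d : ℕ} (g : SLR d) {E : Type*} [Zero E] {f : (Fin d → ℝ) → E}
    (hf : HasCompactSupport f) :
    (Function.support fun p : {p : Fin d → ℤ // p ≠ 0} =>
      f ((g : Matrix (Fin d) (Fin d) ℝ).mulVec fun i => ((p : Fin d → ℤ) i : ℝ))).Finite := by
  have hK : IsCompact ((fun v => ((g⁻¹ : SLR d) : Matrix (Fin d) (Fin d) ℝ).mulVec v) ''
      tsupport f) :=
    hf.isCompact.image (Continuous.matrix_mulVec continuous_const continuous_id)
  have hfin := ((isClosedEmbedding_intCast_pi d).isCompact_preimage hK).finite_of_discrete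
  refine Set.Finite.subset (hfin.preimage (Subtype.val_injective.injOn)) fun p hp => ?_
  exact ⟨_, subset_tsupport _ hp, mulVec_inv_mulVec g _⟩

theorem integral_latticeMeasureX {d : ℕ} {f : (Fin d → ℝ) → ℝ} (hf : HasCompactSupport f)
    (x : XSp d) :
    ∫ v, f v ∂latticeMeasureX x = siegelX f x := by
  have hfin := finite_lattice_support (Quotient.out x : SLR d) hf
  have hs : Summable fun p : {p : Fin d → ℤ // p ≠ 0} => ((1 : ENNReal)).toReal *
      ‖f (((Quotient.out x : SLR d) : Matrix (Fin d) (Fin d) ℝ).mulVec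
        fun i => ((p : Fin d → ℤ) i : ℝ))‖ := by
    refine summable_of_hasFiniteSupport (hfin.subset fun p hp => ?_)
    contrapose! hp
    simp only [Function.mem_support, not_not] at hp ⊢
    simp [hp]
  have := integral_sum_dirac_eq_tsum (fun _ => ENNReal.one_ne_top) hs
  simpa [latticeMeasureX, latticeMeasure, siegelX, siegelM] using this

theorem aestronglyMeasurable_of_ae_continuousAt {X : Type*} [TopologicalSpace X]
    [MeasurableSpace X] [BorelSpace X] [SecondCountableTopology X] {ν : Measure X} {f : X → ℝ}
    (hf : ν {v | ¬ ContinuousAt f v} = 0) : AEStronglyMeasurable f ν := by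
  have hm : MeasurableSet {v | ContinuousAt f v} := (IsGδ.setOfPred_continuousAt f).measurableSet
  have h1 : ν.restrict {v | ContinuousAt f v} = ν :=
    Measure.restrict_eq_self_of_ae_mem (by rw [ae_iff]; simpa using hf)
  rw [← h1]
  exact ContinuousOn.aestronglyMeasurable
    (fun v hv => ContinuousAt.continuousWithinAt hv) hm

theorem integrable_siegelX_and_integral_eq {d : ℕ} {μ : Measure (XSp d)} {f : (Fin d → ℝ) → ℝ}
    (hfc : HasCompactSupport f) (hf : Integrable f (siegelMeasure μ)) :
    Integrable (siegelX f) μ ∧ ∫ v, f v ∂siegelMeasure μ = ∫ x, siegelX f x ∂μ := by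
  let K : ProbabilityTheory.Kernel (XSp d) (Fin d → ℝ) :=
    ⟨latticeMeasureX, measurable_latticeMeasureX d⟩
  have hK : ∀ x, ∫ v, f v ∂K x = siegelX f x := integral_latticeMeasureX hfc
  have hf' : Integrable f (μ.bind K) := hf
  rw [Measure.comp_eq_comp_const_apply] at hf'
  constructor
  · simpa only [ProbabilityTheory.Kernel.const_apply, hK] using hf'.integral_comp
  · have h := ProbabilityTheory.Kernel.integral_comp hf'
    rw [← Measure.comp_eq_comp_const_apply] at h
    simp only [ProbabilityTheory.Kernel.const_apply, hK] at h
    exact h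

/-- If the averages of `F` along some transformations in `SL_d(ℝ)` converge pointwise to a
constant, then this constant is the mean value of `F`. -/
theorem lintegral_eq_of_tendsto_average {d : ℕ} {μ : Measure (XSp d)} [IsProbabilityMeasure μ]
    (hμ : ∀ h : SLR d, MeasurePreserving (fun x : XSp d => h • x) μ μ)
    {S : Type*} [TopologicalSpace S] [SecondCountableTopology S] [MeasurableSpace S]
    [BorelSpace S] (P : Measure S) [IsProbabilityMeasure P]
    {h : ℕ → S → SLR d} (hh : ∀ n, Continuous (h n))
    {F : XSp d → ENNReal} (hF : Measurable F) {c : ENNReal}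
    (hlim : ∀ x, Tendsto (fun n => ∫⁻ s, F (h n s • x) ∂P) atTop (𝓝 c)) :
    ∫⁻ x, F x ∂μ = c := by
  have hmeas : ∀ {G : XSp d → ENNReal}, Measurable G → ∀ n,
      Measurable (Function.uncurry fun (x : XSp d) (s : S) => G (h n s • x)) := by
    intro G hG n
    have hc : Continuous fun q : XSp d × S => h n q.2 • q.1 :=
      ((hh n).comp continuous_snd).smul continuous_fst
    exact hG.comp hc.measurable
  have havg : ∀ {G : XSp d → ENNReal}, Measurable G → ∀ n,
      ∫⁻ x, ∫⁻ s, G (h n s • x) ∂P ∂μ = ∫⁻ x, G x ∂μ := by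
    intro G hG n
    rw [lintegral_lintegral_swap (hmeas hG n).aemeasurable]
    have : ∀ s, ∫⁻ x, G (h n s • x) ∂μ = ∫⁻ x, G x ∂μ := fun s =>
      (hμ (h n s)).lintegral_comp hG
    simp [this]
  have hA : ∀ n, Measurable fun x => ∫⁻ s, F (h n s • x) ∂P := fun n =>
    (hmeas hF n).lintegral_prod_right'
  apply le_antisymm
  · have hM : ∀ M : ℕ, ∫⁻ x, min (F x) M ∂μ ≤ c := by
      intro M
      have h1 : Tendsto (fun n => ∫⁻ x, min (∫⁻ s, F (h n s • x) ∂P) M ∂μ) atTop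
          (𝓝 (∫⁻ _, min c M ∂μ)) := by
        refine tendsto_lintegral_of_dominated_convergence (fun _ => (M : ENNReal))
          (fun n => (hA n).min measurable_const) (fun n => ae_of_all _ fun x => min_le_right _ _)
          (by simp) (ae_of_all _ fun x => (hlim x).min tendsto_const_nhds)
      have h2 : ∫⁻ x, min (F x) M ∂μ ≤ ∫⁻ _, min c M ∂μ := by
        refine ge_of_tendsto' h1 fun n => ?_
        rw [← havg (hF.min measurable_const) n]
        refine lintegral_mono fun x => le_min (lintegral_mono fun s => min_le_left _ _) ?_
        exact (lintegral_mono fun s => min_le_right _ _).trans (by simp)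
      exact h2.trans (by simp)
    have hsup : ∀ x, F x = ⨆ M : ℕ, min (F x) M := by
      intro x
      rw [← inf_iSup_eq, ENNReal.iSup_natCast, inf_top_eq]
    rw [lintegral_congr hsup, lintegral_iSup (fun M => hF.min measurable_const)
      (fun a b hab x => min_le_min_left _ (by exact_mod_cast hab))]
    exact iSup_le hM
  · calc c = ∫⁻ _, c ∂μ := by simp
      _ = ∫⁻ x, liminf (fun n => ∫⁻ s, F (h n s • x) ∂P) atTop ∂μ :=
          lintegral_congr fun x => (hlim x).liminf_eq.symm
      _ ≤ liminf (fun n => ∫⁻ x, ∫⁻ s, F (h n s • x) ∂P ∂μ) atTop := lintegral_liminf_le hA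
      _ = ∫⁻ x, F x ∂μ := by simp [havg hF]

theorem finite_support_intCast {d : ℕ} {F : (Fin d → ℝ) → ℝ} (hF : HasCompactSupport F) {n : ℕ}
    (hn : n ≠ 0) :
    (Function.support fun p : Fin d → ℤ => F ((n : ℝ)⁻¹ • fun i => (p i : ℝ))).Finite := by
  have hn' : (n : ℝ)⁻¹ ≠ 0 := by positivity
  have hK := (isClosedEmbedding_intCast_pi d).isCompact_preimage
    ((Homeomorph.smulOfNeZero _ hn').isClosedEmbedding.isCompact_preimage hF.isCompact)
  exact hK.finite_of_discrete.subset fun p hp => subset_tsupport _ hp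

open scoped Pointwise in
theorem tendsto_riemann_sum {d : ℕ} {F : (Fin d → ℝ) → ℝ} (hF : Continuous F)
    (hFc : HasCompactSupport F) :
    Tendsto (fun n : ℕ => (∑' p : Fin d → ℤ, F ((n : ℝ)⁻¹ • fun i => (p i : ℝ))) / (n : ℝ) ^ d)
      atTop (𝓝 (∫ v, F v)) := by
  obtain ⟨r, hr⟩ := hFc.isCompact.isBounded.subset_closedBall 0
  have h := tendsto_tsum_div_pow_atTop_integral (Metric.closedBall (0 : Fin d → ℝ) r) F hF
    Metric.isBounded_closedBall measurableSet_closedBall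
    ((convex_closedBall _ _).addHaar_frontier _)
  have hz : ∀ v, v ∉ Metric.closedBall (0 : Fin d → ℝ) r → F v = 0 := fun v hv =>
    image_eq_zero_of_notMem_tsupport fun h => hv (hr h)
  rw [setIntegral_eq_integral_of_forall_compl_eq_zero hz, Fintype.card_fin] at h
  refine h.congr' ?_
  filter_upwards [eventually_ne_atTop 0] with n hn
  have hn' : (n : ℝ)⁻¹ ≠ 0 := by positivity
  congr 1
  let e : (Fin d → ℤ) → (Fin d → ℝ) := fun p => (n : ℝ)⁻¹ • fun i => (p i : ℝ)
  have he : Function.Injective e := fun p q hpq =>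
    (isClosedEmbedding_intCast_pi d).injective (smul_right_injective _ hn' hpq)
  have hrange : (n : ℝ)⁻¹ • ((Submodule.span ℤ (Set.range (Pi.basisFun ℝ (Fin d))) :
      Submodule ℤ (Fin d → ℝ)) : Set (Fin d → ℝ)) = Set.range e := by
    ext v
    constructor
    · rintro ⟨w, hw, rfl⟩
      obtain ⟨p, hp⟩ : ∃ p : Fin d → ℤ, ∀ i, (p i : ℝ) = w i := by
        have := (Pi.basisFun ℝ (Fin d)).mem_span_iff_repr_mem ℤ w |>.1 hw
        simp only [Pi.basisFun_repr] at this
        choose p hp using this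
        exact ⟨p, fun i => by simpa using hp i⟩
      exact ⟨p, by simp [e, hp]⟩
    · rintro ⟨p, rfl⟩
      refine ⟨fun i => (p i : ℝ), ?_, rfl⟩
      refine ((Pi.basisFun ℝ (Fin d)).mem_span_iff_repr_mem ℤ _).2 fun i => ⟨p i, by simp⟩
  rw [hrange]
  change _ = ∑' p, F (e p)
  rw [← tsum_range F he, tsum_subtype, tsum_subtype]
  refine tsum_congr fun v => ?_
  by_cases h1 : v ∈ Set.range e <;> by_cases h2 : v ∈ Metric.closedBall (0 : Fin d → ℝ) r
  · rw [Set.indicator_of_mem (Set.mem_inter h2 h1), Set.indicator_of_mem h1]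
  · rw [Set.indicator_of_mem h1, Set.indicator_of_notMem (fun h => h2 h.1), hz v h2]
  · rw [Set.indicator_of_notMem h1, Set.indicator_of_notMem (fun h => h1 h.2)]
  · rw [Set.indicator_of_notMem h1, Set.indicator_of_notMem (fun h => h1 h.2)]

theorem tendsto_riemann_sum_moving {d : ℕ} {Φ : ℝ × (Fin d → ℝ) → ℝ} (hΦ : Continuous Φ) {r : ℝ}
    (hr : ∀ t ∈ Set.Icc (0 : ℝ) 1, ∀ v, r < ‖v‖ → Φ (t, v) = 0)
    {N : ℕ → ℕ} (hN : Tendsto N atTop atTop) {t : ℕ → ℝ} (ht : ∀ k, t k ∈ Set.Icc (0 : ℝ) 1)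
    (ht0 : Tendsto t atTop (𝓝 0)) :
    Tendsto (fun k : ℕ => (∑' p : Fin d → ℤ, Φ (t k, (N k : ℝ)⁻¹ • fun i => (p i : ℝ))) /
      (N k : ℝ) ^ d) atTop (𝓝 (∫ v, Φ (0, v))) := by
  have hsupp : ∀ s ∈ Set.Icc (0 : ℝ) 1, HasCompactSupport fun v => Φ (s, v) := fun s hs =>
    HasCompactSupport.intro (isCompact_closedBall 0 r) fun v hv =>
      hr s hs v (by simpa using hv)
  let χ : (Fin d → ℝ) → ℝ := fun v => max 0 (r + 1 - ‖v‖)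
  have hχ : Continuous χ := by fun_prop
  have hχc : HasCompactSupport χ :=
    HasCompactSupport.intro (isCompact_closedBall 0 (r + 1)) fun v hv => by
      simp only [Metric.mem_closedBall, dist_zero_right, not_le] at hv
      simp only [χ, max_eq_left_iff]
      linarith
  have hlim0 := (tendsto_riemann_sum (hΦ.comp (Continuous.prodMk_right 0))
    (hsupp 0 (by simp))).comp hN
  have hlimχ := (tendsto_riemann_sum hχ hχc).comp hN
  set I := ∫ v, χ v with hI
  have hI0 : 0 ≤ I := integral_nonneg fun v => le_max_left _ _
  refine (tendsto_iff_of_dist ?_).1 hlim0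
  rw [Metric.tendsto_nhds]
  intro ε hε
  have hδ : 0 < ε / (I + 2) := by positivity
  have hunif : ∀ᶠ s in 𝓝 (0 : ℝ), ∀ v ∈ Metric.closedBall (0 : Fin d → ℝ) r,
      dist (Φ (0, v)) (Φ (s, v)) < ε / (I + 2) := by
    refine (isCompact_closedBall _ _).eventually_forall_of_forall_eventually fun v _ => ?_
    have hc : Continuous fun q : ℝ × (Fin d → ℝ) => dist (Φ (0, q.2)) (Φ (q.1, q.2)) := by
      fun_prop
    have := hc.tendsto (0, v)
    simp only [dist_self] at this
    exact this.eventually (gt_mem_nhds hδ)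
  filter_upwards [ht0.eventually hunif, hlimχ.eventually (gt_mem_nhds (lt_add_one I)),
    hN.eventually (eventually_ne_atTop 0)] with k h1 h2 h3
  have hpos : (0 : ℝ) < (N k : ℝ) ^ d := by positivity
  have hb : ∀ v, ‖Φ (0, v) - Φ (t k, v)‖ ≤ ε / (I + 2) * χ v := by
    intro v
    by_cases hv : v ∈ Metric.closedBall (0 : Fin d → ℝ) r
    · have h4 := (h1 v hv).le
      rw [dist_eq_norm] at h4
      refine h4.trans (le_mul_of_one_le_right hδ.le ?_)
      simp only [Metric.mem_closedBall, dist_zero_right] at hv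
      exact le_max_of_le_right (by linarith)
    · have hv' : r < ‖v‖ := by simpa using hv
      rw [hr 0 (by simp) v hv', hr _ (ht k) v hv', sub_self, norm_zero]
      exact mul_nonneg hδ.le (le_max_left _ _)
  have hs0 := summable_of_hasFiniteSupport (L := .unconditional _)
    (finite_support_intCast (hsupp 0 (by simp)) h3)
  have hsk := summable_of_hasFiniteSupport (L := .unconditional _)
    (finite_support_intCast (hsupp _ (ht k)) h3)
  have hsχ := summable_of_hasFiniteSupport (L := .unconditional _) (finite_support_intCast hχc h3)
  have hle := tsum_of_norm_bounded (f := fun p : Fin d → ℤ =>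
      Φ (0, (N k : ℝ)⁻¹ • fun i => (p i : ℝ)) - Φ (t k, (N k : ℝ)⁻¹ • fun i => (p i : ℝ)))
    (hsχ.mul_left (ε / (I + 2))).hasSum
    fun p => hb ((N k : ℝ)⁻¹ • fun i => (p i : ℝ))
  rw [hs0.tsum_sub hsk, tsum_mul_left] at hle
  rw [dist_zero_right, Real.norm_eq_abs, abs_of_nonneg dist_nonneg, dist_eq_norm]
  simp only [Function.comp_apply] at h2 ⊢
  rw [← sub_div, norm_div, Real.norm_of_nonneg hpos.le]
  calc _ ≤ ε / (I + 2) * (∑' p : Fin d → ℤ, χ ((N k : ℝ)⁻¹ • fun i => (p i : ℝ))) /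
        (N k : ℝ) ^ d := by gcongr
    _ ≤ ε / (I + 2) * (I + 1) := by
        rw [mul_div_assoc]
        exact mul_le_mul_of_nonneg_left h2.le hδ.le
    _ < ε := by
        rw [div_mul_eq_mul_div, div_lt_iff₀ (by positivity)]
        nlinarith

/-- Riemann sums over a unimodular lattice. -/
theorem tendsto_lattice_riemann_sum {d : ℕ} (g : SLR d) {Φ : ℝ × (Fin d → ℝ) → ℝ}
    (hΦ : Continuous Φ) {r : ℝ}
    (hr : ∀ t ∈ Set.Icc (0 : ℝ) 1, ∀ v, r < ‖v‖ → Φ (t, v) = 0)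
    {N : ℕ → ℕ} (hN : Tendsto N atTop atTop) {t : ℕ → ℝ} (ht : ∀ k, t k ∈ Set.Icc (0 : ℝ) 1)
    (ht0 : Tendsto t atTop (𝓝 0)) :
    Tendsto (fun k : ℕ => (∑' p : Fin d → ℤ, Φ (t k, (N k : ℝ)⁻¹ •
      (g : Matrix (Fin d) (Fin d) ℝ).mulVec fun i => (p i : ℝ))) / (N k : ℝ) ^ d)
      atTop (𝓝 (∫ v, Φ (0, v))) := by
  have hgc : Continuous fun v : Fin d → ℝ => (g : Matrix (Fin d) (Fin d) ℝ).mulVec v :=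
    Continuous.matrix_mulVec continuous_const continuous_id
  obtain ⟨r', hr'⟩ := ((isCompact_closedBall (0 : Fin d → ℝ) r).image
    (f := fun v => ((g⁻¹ : SLR d) : Matrix (Fin d) (Fin d) ℝ).mulVec v)
    (Continuous.matrix_mulVec continuous_const continuous_id)).isBounded.subset_closedBall 0
  have h := tendsto_riemann_sum_moving
    (Φ := fun q => Φ (q.1, (g : Matrix (Fin d) (Fin d) ℝ).mulVec q.2)) (by fun_prop) (r := r')
    (fun s hs v hv => hr s hs _ ?_) hN ht ht0
  · simp only [Matrix.mulVec_smul] at h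
    convert h using 2
    have hmp : MeasurePreserving
        (fun v : Fin d → ℝ => (g : Matrix (Fin d) (Fin d) ℝ).mulVec v) volume volume :=
      ⟨hgc.measurable, by
        ext s hs
        rw [Measure.map_apply hgc.measurable hs, volume_preimage_mulVec]⟩
    have hemb : MeasurableEmbedding
        (fun v : Fin d → ℝ => (g : Matrix (Fin d) (Fin d) ℝ).mulVec v) :=
      hgc.measurableEmbedding fun v w hvw => by
        rw [← mulVec_inv_mulVec g v, ← mulVec_inv_mulVec g w]
        exact congrArg _ hvw
    exact (hmp.integral_comp hemb fun v => Φ (0, v)).symm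
  · by_contra! hle
    have := hr' ⟨_, by simpa using hle, mulVec_inv_mulVec g v⟩
    simp only [Metric.mem_closedBall, dist_zero_right] at this
    linarith

/-- The matrix of `(x, y) ↦ (x / k ^ m, k (y + x s))` on `ℝ × ℝ^m`. -/
def shearMatrix (m k : ℕ) (s : Fin m → ℝ) : Matrix (Fin (m + 1)) (Fin (m + 1)) ℝ :=
  Matrix.of fun i j => Fin.cases (Fin.cases ((k : ℝ) ^ m)⁻¹ (fun _ => 0) j)
    (fun i' => Fin.cases ((k : ℝ) * s i') (fun j' => if i' = j' then (k : ℝ) else 0) j) i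

theorem det_shearMatrix {m k : ℕ} (hk : k ≠ 0) (s : Fin m → ℝ) : (shearMatrix m k s).det = 1 := by
  have hk' : (k : ℝ) ≠ 0 := by exact_mod_cast hk
  rw [Matrix.det_of_isLowerTriangular, Fin.prod_univ_succ]
  · simp [shearMatrix, hk']
  · intro i j hij
    have hij' : i < j := hij
    induction j using Fin.cases with
    | zero => simp at hij'
    | succ j =>
      induction i using Fin.cases with
      | zero => simp [shearMatrix]
      | succ i =>
        have : i ≠ j := fun h => by simp [h] at hij'
        simp [shearMatrix, this]

theorem shearMatrix_mulVec {m k : ℕ} (s : Fin m → ℝ) (v : Fin (m + 1) → ℝ) :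
    (shearMatrix m k s).mulVec v =
      Fin.cons (((k : ℝ) ^ m)⁻¹ * v 0) ((k : ℝ) • Fin.tail v + ((k : ℝ) * v 0) • s) := by
  ext i
  induction i using Fin.cases with
  | zero => simp [shearMatrix, Matrix.mulVec, dotProduct, Fin.sum_univ_succ]
  | succ i =>
    simp [shearMatrix, Matrix.mulVec, dotProduct, Fin.sum_univ_succ, Fin.tail]
    ring

/-- The shears `shearMatrix`, as elements of `SL_{m+1}(ℝ)`. -/
def shear (m n : ℕ) (s : Fin m → ℝ) : SLR (m + 1) :=
  ⟨shearMatrix m (n + 1) s, det_shearMatrix n.succ_ne_zero s⟩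

theorem continuous_shear (m n : ℕ) : Continuous (shear m n) := by
  refine Continuous.subtype_mk (continuous_matrix fun i j => ?_) _
  induction i using Fin.cases <;> induction j using Fin.cases <;> simp [shearMatrix] <;> fun_prop

theorem integral_fin_cons {m : ℕ} {F : (Fin (m + 1) → ℝ) → ℝ} (hF : Integrable F) :
    ∫ v, F v = ∫ x : ℝ, ∫ w : Fin m → ℝ, F (Fin.cons x w) := by
  have h := (volume_preserving_piFinSuccAbove (fun _ : Fin (m + 1) => ℝ) 0).symm
  rw [← h.integral_comp' F, Measure.volume_eq_prod, integral_prod]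
  · simp [MeasurableEquiv.piFinSuccAbove, Fin.insertNthEquiv]
  · rw [← Measure.volume_eq_prod]
    exact (h.integrable_comp_emb (MeasurableEquiv.measurableEmbedding _)).2 hF

/-- The rescaled average of `f` over shears with density `ρ`. -/
def shearAverage {m : ℕ} (f : (Fin (m + 1) → ℝ) → ℝ) (ρ : (Fin m → ℝ) → ℝ) (ε r : ℝ)
    (q : ℝ × (Fin (m + 1) → ℝ)) : ℝ :=
  ((max (q.2 0) ε) ^ m)⁻¹ * ∫ w in Metric.closedBall (0 : Fin m → ℝ) r,
    f (Fin.cons (q.2 0) w) * ρ ((max (q.2 0) ε)⁻¹ • (q.1 • w - Fin.tail q.2))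

theorem continuous_shearAverage {m : ℕ} {f : (Fin (m + 1) → ℝ) → ℝ} {ρ : (Fin m → ℝ) → ℝ}
    {ε : ℝ} (r : ℝ) (hf : Continuous f) (hρ : Continuous ρ) (hε : 0 < ε) :
    Continuous (shearAverage f ρ ε r) := by
  have hpos : ∀ q : ℝ × (Fin (m + 1) → ℝ), max (q.2 0) ε ≠ 0 := fun q =>
    (hε.trans_le (le_max_right _ _)).ne'
  have hmax : Continuous fun q : ℝ × (Fin (m + 1) → ℝ) => max (q.2 0) ε := by fun_prop
  refine ((hmax.pow m).inv₀ fun q => pow_ne_zero _ (hpos q)).mul ?_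
  refine continuous_parametric_integral_of_continuous ?_ (isCompact_closedBall _ _)
  have h1 : Continuous fun z : (ℝ × (Fin (m + 1) → ℝ)) × (Fin m → ℝ) =>
      (Fin.cons (z.1.2 0) z.2 : Fin (m + 1) → ℝ) := by
    refine continuous_pi fun i => ?_
    induction i using Fin.cases <;> simp <;> fun_prop
  have h2 : Continuous fun z : (ℝ × (Fin (m + 1) → ℝ)) × (Fin m → ℝ) => Fin.tail z.1.2 := by
    refine continuous_pi fun i => ?_
    simp only [Fin.tail]
    fun_prop
  refine (hf.comp h1).mul (hρ.comp ?_)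
  exact ((hmax.comp continuous_fst).inv₀ fun z => hpos z.1).smul
    (((continuous_fst.comp continuous_fst).smul continuous_snd).sub h2)

theorem norm_fin_cons_ge {m : ℕ} (x : ℝ) (w : Fin m → ℝ) :
    |x| ≤ ‖(Fin.cons x w : Fin (m + 1) → ℝ)‖ ∧ ‖w‖ ≤ ‖(Fin.cons x w : Fin (m + 1) → ℝ)‖ := by
  constructor
  · simpa using norm_le_pi_norm (Fin.cons x w : Fin (m + 1) → ℝ) 0
  · refine (pi_norm_le_iff_of_nonneg (norm_nonneg _)).2 fun i => ?_
    simpa using norm_le_pi_norm (Fin.cons x w : Fin (m + 1) → ℝ) i.succ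

theorem shearAverage_eq_zero {m : ℕ} {f : (Fin (m + 1) → ℝ) → ℝ} {ρ : (Fin m → ℝ) → ℝ}
    {ε r R : ℝ} (hr0 : 0 ≤ r) (hR0 : 0 ≤ R) (hε : 0 < ε) (hr : ∀ v, r < ‖v‖ → f v = 0)
    (hR : ∀ s, R < ‖s‖ → ρ s = 0) {t : ℝ} (ht : t ∈ Set.Icc (0 : ℝ) 1)
    {v : Fin (m + 1) → ℝ} (hv : r + max r ε * R < ‖v‖) :
    shearAverage f ρ ε r (t, v) = 0 := by
  rw [shearAverage, setIntegral_eq_zero_of_forall_eq_zero, mul_zero]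
  intro w hw
  by_contra hne
  have h1 : |v 0| ≤ r := (norm_fin_cons_ge (v 0) w).1.trans
    (not_lt.1 fun h => (mul_ne_zero_iff.1 hne).1 (hr _ h))
  have h2 : ‖(max (v 0) ε)⁻¹ • (t • w - Fin.tail v)‖ ≤ R :=
    not_lt.1 fun h => (mul_ne_zero_iff.1 hne).2 (hR _ h)
  have hq : 0 < max (v 0) ε := hε.trans_le (le_max_right _ _)
  have hq' : max (v 0) ε ≤ max r ε := max_le_max_right _ ((le_abs_self _).trans h1)
  rw [norm_smul, norm_inv, Real.norm_of_nonneg hq.le, inv_mul_le_iff₀ hq] at h2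
  have h3 : ‖t • w‖ ≤ r := by
    rw [norm_smul, Real.norm_of_nonneg ht.1]
    have : ‖w‖ ≤ r := by simpa using hw
    nlinarith [ht.2, norm_nonneg w]
  have h4 : ‖Fin.tail v‖ ≤ r + max r ε * R := by
    have h5 := norm_sub_norm_le (Fin.tail v) (t • w)
    rw [norm_sub_rev] at h5
    have := mul_le_mul_of_nonneg_right hq' hR0
    linarith
  refine hv.not_ge ((pi_norm_le_iff_of_nonneg (by positivity)).2 fun i => ?_)
  induction i using Fin.cases with
  | zero =>
    rw [Real.norm_eq_abs]
    have : 0 ≤ max r ε * R := by positivity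
    linarith
  | succ i => exact (norm_le_pi_norm (Fin.tail v) i).trans h4

theorem setIntegral_closedBall_eq {m : ℕ} {f : (Fin (m + 1) → ℝ) → ℝ} {r : ℝ}
    (hr : ∀ v, r < ‖v‖ → f v = 0) (x : ℝ) (b : (Fin m → ℝ) → ℝ) :
    ∫ w in Metric.closedBall (0 : Fin m → ℝ) r, f (Fin.cons x w) * b w =
      ∫ w, f (Fin.cons x w) * b w := by
  refine setIntegral_eq_integral_of_forall_compl_eq_zero fun w hw => ?_
  rw [hr _ ((by simpa using hw : r < ‖w‖).trans_le (norm_fin_cons_ge x w).2), zero_mul]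

theorem integral_shearAverage {m : ℕ} {f : (Fin (m + 1) → ℝ) → ℝ} {ρ : (Fin m → ℝ) → ℝ}
    {ε r R : ℝ} (hr0 : 0 ≤ r) (hR0 : 0 ≤ R) (hε : 0 < ε) (hf : Continuous f) (hρ : Continuous ρ)
    (hr : ∀ v, r < ‖v‖ → f v = 0) (hR : ∀ s, R < ‖s‖ → ρ s = 0) (hρ1 : ∫ s, ρ s = 1) :
    ∫ v, shearAverage f ρ ε r (0, v) = ∫ v, f v := by
  have hΦ : Continuous fun v => shearAverage f ρ ε r (0, v) :=
    (continuous_shearAverage r hf hρ hε).comp (Continuous.prodMk_right 0)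
  have hΦc : HasCompactSupport fun v => shearAverage f ρ ε r (0, v) :=
    HasCompactSupport.intro (isCompact_closedBall 0 (r + max r ε * R)) fun v hv =>
      shearAverage_eq_zero hr0 hR0 hε hr hR (by simp) (by simpa using hv)
  have hfc : HasCompactSupport f :=
    HasCompactSupport.intro (isCompact_closedBall 0 r) fun v hv => hr v (by simpa using hv)
  rw [integral_fin_cons (hΦ.integrable_of_hasCompactSupport hΦc),
    integral_fin_cons (hf.integrable_of_hasCompactSupport hfc)]
  refine integral_congr_ae (ae_of_all _ fun x => ?_)
  have hq : 0 < max x ε := hε.trans_le (le_max_right _ _)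
  have h1 : ∀ y : Fin m → ℝ, shearAverage f ρ ε r (0, Fin.cons x y) =
      ((max x ε) ^ m)⁻¹ * (∫ w, f (Fin.cons x w)) * ρ ((max x ε)⁻¹ • -y) := by
    intro y
    simp only [shearAverage, Fin.cons_zero, Fin.tail_cons, zero_smul, zero_sub]
    rw [setIntegral_closedBall_eq hr x fun _ => ρ ((max x ε)⁻¹ • -y), integral_mul_const,
      mul_assoc]
  simp only [h1]
  rw [integral_const_mul, integral_neg_eq_self (fun y => ρ ((max x ε)⁻¹ • y)),
    Measure.integral_comp_smul, hρ1, Module.finrank_fin_fun, inv_pow, inv_inv, smul_eq_mul, mul_one,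
    abs_of_pos (pow_pos hq _)]
  field_simp

theorem integral_shear {m n : ℕ} {f : (Fin (m + 1) → ℝ) → ℝ} (ρ : (Fin m → ℝ) → ℝ)
    {ε r : ℝ} (hε : 0 < ε) (hr : ∀ v, r < ‖v‖ → f v = 0) (hfε : ∀ v, v 0 < ε → f v = 0)
    (v : Fin (m + 1) → ℝ) :
    ∫ s, f ((shear m n s : Matrix (Fin (m + 1)) (Fin (m + 1)) ℝ).mulVec v) * ρ s =
      shearAverage f ρ ε r ((((n + 1 : ℕ) : ℝ) ^ (m + 1))⁻¹,
        (((n + 1) ^ m : ℕ) : ℝ)⁻¹ • v) / (((n + 1) ^ m : ℕ) : ℝ) ^ (m + 1) := by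
  have hv : ∀ s, (shear m n s : Matrix (Fin (m + 1)) (Fin (m + 1)) ℝ).mulVec v = _ :=
    fun s => shearMatrix_mulVec s v
  simp only [hv, shearAverage, Nat.cast_pow]
  set k : ℝ := ((n + 1 : ℕ) : ℝ) with hk
  have hk0 : 0 < k := by positivity
  rw [setIntegral_closedBall_eq hr]
  simp only [Pi.smul_apply, smul_eq_mul]
  rcases lt_or_ge ((k ^ m)⁻¹ * v 0) ε with hx | hx
  · have h0 : ∀ w : Fin m → ℝ, f (Fin.cons ((k ^ m)⁻¹ * v 0) w) = 0 := fun w =>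
      hfε _ (by simpa using hx)
    simp [h0]
  · rw [max_eq_left hx]
    have hv0 : 0 < v 0 := by
      have h := hε.trans_le hx
      by_contra! hneg
      exact h.not_ge (mul_nonpos_of_nonneg_of_nonpos (by positivity) hneg)
    have hkv : 0 < k * v 0 := by positivity
    let H : (Fin m → ℝ) → ℝ := fun w =>
      f (Fin.cons ((k ^ m)⁻¹ * v 0) w) * ρ ((k * v 0)⁻¹ • (w - k • Fin.tail v))
    have e1 : ∀ s, f (Fin.cons ((k ^ m)⁻¹ * v 0) (k • Fin.tail v + (k * v 0) • s)) * ρ s =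
        H (k • Fin.tail v + (k * v 0) • s) := by
      intro s
      simp only [H, add_sub_cancel_left, inv_smul_smul₀ hkv.ne']
    have e2 : ∀ w, f (Fin.cons ((k ^ m)⁻¹ * v 0) w) *
        ρ (((k ^ m)⁻¹ * v 0)⁻¹ • ((k ^ (m + 1))⁻¹ • w - Fin.tail ((k ^ m)⁻¹ • v))) = H w := by
      intro w
      simp only [H]
      congr 2
      ext i
      simp only [Fin.tail, Pi.smul_apply, Pi.sub_apply, smul_eq_mul]
      field_simp
      ring
    simp only [e1, e2]
    rw [Measure.integral_comp_smul volume (fun w => H (k • Fin.tail v + w)) (k * v 0),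
      integral_add_left_eq_self H, Module.finrank_fin_fun, abs_of_pos (by positivity), smul_eq_mul]
    field_simp
    rw [div_pow, mul_pow, pow_succ (k ^ m)]
    field_simp

theorem lintegral_shear_latticeMeasure {m n : ℕ} (g : SLR (m + 1))
    {f : (Fin (m + 1) → ℝ) → ℝ} {ρ : (Fin m → ℝ) → ℝ} {ε r R : ℝ}
    (hr0 : 0 ≤ r) (hR0 : 0 ≤ R) (hε : 0 < ε) (hf : Continuous f) (hf0 : ∀ v, 0 ≤ f v)
    (hρ : Continuous ρ) (hρ0 : ∀ s, 0 ≤ ρ s) (hr : ∀ v, r < ‖v‖ → f v = 0)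
    (hfε : ∀ v, v 0 < ε → f v = 0) (hR : ∀ s, R < ‖s‖ → ρ s = 0) :
    ∫⁻ s, ∫⁻ v, ENNReal.ofReal (f v) ∂latticeMeasureX (shear m n s • (g : XSp (m + 1)))
        ∂volume.withDensity (fun s => ENNReal.ofReal (ρ s)) =
      ENNReal.ofReal ((∑' p : Fin (m + 1) → ℤ, shearAverage f ρ ε r
        ((((n + 1 : ℕ) : ℝ) ^ (m + 1))⁻¹, (((n + 1) ^ m : ℕ) : ℝ)⁻¹ •
          (g : Matrix (Fin (m + 1)) (Fin (m + 1)) ℝ).mulVec fun i => (p i : ℝ))) /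
        (((n + 1) ^ m : ℕ) : ℝ) ^ (m + 1)) := by
  set t : ℝ := (((n + 1 : ℕ) : ℝ) ^ (m + 1))⁻¹ with ht
  set N : ℝ := (((n + 1) ^ m : ℕ) : ℝ) with hN
  have hN0 : 0 < N := by positivity
  have ht1 : t ∈ Set.Icc (0 : ℝ) 1 :=
    ⟨by positivity, inv_le_one_of_one_le₀ (one_le_pow₀ (by simp))⟩
  let Φ : (Fin (m + 1) → ℝ) → ℝ := fun v => shearAverage f ρ ε r (t, N⁻¹ • v) / N ^ (m + 1)
  have hΦ : ∀ v, ∫ s, f ((shear m n s : Matrix (Fin (m + 1)) (Fin (m + 1)) ℝ).mulVec v) * ρ s =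
      Φ v := integral_shear ρ hε hr hfε
  have hΦ0 : ∀ v, 0 ≤ Φ v := fun v => by
    rw [← hΦ]
    exact integral_nonneg fun s => mul_nonneg (hf0 _) (hρ0 _)
  have hΦc : HasCompactSupport Φ := by
    refine HasCompactSupport.intro (isCompact_closedBall 0 (N * (r + max r ε * R)))
      fun v hv => ?_
    simp only [Φ]
    rw [shearAverage_eq_zero hr0 hR0 hε hr hR ht1, zero_div]
    rw [norm_smul, norm_inv, Real.norm_of_nonneg hN0.le, lt_inv_mul_iff₀ hN0]
    simpa using hv
  have hρm : Measurable fun s => ENNReal.ofReal (ρ s) := hρ.measurable.ennreal_ofReal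
  have hcont : ∀ v, Continuous fun s =>
      f ((shear m n s : Matrix (Fin (m + 1)) (Fin (m + 1)) ℝ).mulVec v) := fun v =>
    hf.comp (((continuous_coe_SLR (m + 1)).comp (continuous_shear m n)).matrix_mulVec
      continuous_const)
  have hint : ∀ v, ∫⁻ s, ENNReal.ofReal
      (f ((shear m n s : Matrix (Fin (m + 1)) (Fin (m + 1)) ℝ).mulVec v))
        ∂volume.withDensity (fun s => ENNReal.ofReal (ρ s)) = ENNReal.ofReal (Φ v) := by
    intro v
    rw [lintegral_withDensity_eq_lintegral_mul _ hρm (hcont v).measurable.ennreal_ofReal, ← hΦ,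
      ofReal_integral_eq_lintegral_ofReal]
    · refine lintegral_congr fun s => ?_
      rw [Pi.mul_apply, ENNReal.ofReal_mul (hf0 _), mul_comm]
    · refine ((hcont v).mul hρ).integrable_of_hasCompactSupport ?_
      refine HasCompactSupport.intro (isCompact_closedBall 0 R) fun s hs => ?_
      rw [Pi.mul_apply, hR s (by simpa using hs), mul_zero]
    · exact ae_of_all _ fun s => mul_nonneg (hf0 _) (hρ0 _)
  have hzero : Φ 0 = 0 := by
    rw [← hΦ]
    simp [hfε 0 hε]
  simp_rw [lintegral_latticeMeasureX_smul, latticeMeasureX_mk, lintegral_latticeMeasure]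
  rw [lintegral_tsum fun p => (hcont _).measurable.ennreal_ofReal.aemeasurable]
  simp_rw [hint]
  rw [← ENNReal.ofReal_tsum_of_nonneg (fun p => hΦ0 _)
    (summable_of_hasFiniteSupport (L := .unconditional _) (finite_lattice_support g hΦc)),
    ← tsum_div_const]
  congr 1
  have hsupp : (Function.support fun p : Fin (m + 1) → ℤ =>
      Φ ((g : Matrix (Fin (m + 1)) (Fin (m + 1)) ℝ).mulVec fun i => (p i : ℝ))) ⊆
      {p | p ≠ 0} := by
    intro p hp hp0
    refine hp ?_
    have hp1 : (fun i => (p i : ℝ)) = (0 : Fin (m + 1) → ℝ) := by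
      ext i
      simp [hp0]
    simp only [hp1, Matrix.mulVec_zero, hzero]
  exact tsum_subtype_eq_of_support_subset hsupp

theorem lintegral_siegelMeasure_of_continuous {m : ℕ} (hm : 1 ≤ m) {μ : Measure (XSp (m + 1))}
    [IsProbabilityMeasure μ]
    (hμ : ∀ h : SLR (m + 1), MeasurePreserving (fun x : XSp (m + 1) => h • x) μ μ)
    {f : (Fin (m + 1) → ℝ) → ℝ} {ε r : ℝ} (hr0 : 0 ≤ r) (hε : 0 < ε) (hf : Continuous f)
    (hf0 : ∀ v, 0 ≤ f v) (hr : ∀ v, r < ‖v‖ → f v = 0) (hfε : ∀ v, v 0 < ε → f v = 0) :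
    ∫⁻ v, ENNReal.ofReal (f v) ∂siegelMeasure μ = ∫⁻ v, ENNReal.ofReal (f v) := by
  let φ : ContDiffBump (0 : Fin m → ℝ) := ⟨1, 2, one_pos, one_lt_two⟩
  let ρ : (Fin m → ℝ) → ℝ := φ.normed volume
  have hρ : Continuous ρ := φ.continuous_normed
  have hρ0 : ∀ s, 0 ≤ ρ s := φ.nonneg_normed
  have hρ1 : ∫ s, ρ s = 1 := φ.integral_normed
  have hR : ∀ s, (2 : ℝ) < ‖s‖ → ρ s = 0 := by
    intro s hs
    by_contra hne
    have h : s ∈ Function.support ρ := hne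
    rw [φ.support_normed_eq, mem_ball_zero_iff] at h
    exact hs.not_gt h
  have hρi : Integrable ρ := φ.integrable_normed
  have : IsProbabilityMeasure (volume.withDensity fun s => ENNReal.ofReal (ρ s)) := by
    constructor
    rw [withDensity_apply _ MeasurableSet.univ, Measure.restrict_univ,
      ← ofReal_integral_eq_lintegral_ofReal hρi (ae_of_all _ hρ0), hρ1, ENNReal.ofReal_one]
  have hfc : HasCompactSupport f :=
    HasCompactSupport.intro (isCompact_closedBall 0 r) fun v hv => hr v (by simpa using hv)
  have hfm : Measurable fun v => ENNReal.ofReal (f v) := hf.measurable.ennreal_ofReal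
  rw [lintegral_siegelMeasure μ hfm.aemeasurable, ← ofReal_integral_eq_lintegral_ofReal
    (hf.integrable_of_hasCompactSupport hfc) (ae_of_all _ hf0)]
  refine lintegral_eq_of_tendsto_average hμ
    (volume.withDensity fun s => ENNReal.ofReal (ρ s)) (continuous_shear m)
    ((Measure.measurable_lintegral hfm).comp (measurable_latticeMeasureX _)) fun x => ?_
  induction x using QuotientGroup.induction_on with
  | H g =>
    have h1 : ∀ n : ℕ, (1 : ℝ) ≤ ((n + 1 : ℕ) : ℝ) := by simp
    have ht : ∀ n : ℕ, (((n + 1 : ℕ) : ℝ) ^ (m + 1))⁻¹ ∈ Set.Icc (0 : ℝ) 1 := fun n =>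
      ⟨by positivity, inv_le_one_of_one_le₀ (one_le_pow₀ (h1 n))⟩
    have hN : Tendsto (fun n : ℕ => (n + 1) ^ m) atTop atTop :=
      (tendsto_pow_atTop (by lia)).comp (tendsto_add_atTop_nat 1)
    have ht0 : Tendsto (fun n : ℕ => (((n + 1 : ℕ) : ℝ) ^ (m + 1))⁻¹) atTop (𝓝 0) :=
      tendsto_inv_atTop_zero.comp ((tendsto_pow_atTop m.succ_ne_zero).comp
        (tendsto_natCast_atTop_atTop.comp (tendsto_add_atTop_nat 1)))
    have hlim := tendsto_lattice_riemann_sum g (continuous_shearAverage r hf hρ hε)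
      (fun t ht v hv => shearAverage_eq_zero hr0 zero_le_two hε hr hR ht hv) hN ht ht0
    rw [integral_shearAverage hr0 zero_le_two hε hf hρ hr hR hρ1] at hlim
    refine ((ENNReal.continuous_ofReal.tendsto _).comp hlim).congr fun n => ?_
    exact (lintegral_shear_latticeMeasure g hr0 zero_le_two hε hf hf0 hρ hρ0 hr hfε hR).symm

/-- Continuous functions increasing to `1` on the half-space `0 < v 0`, with supports bounded and
away from its boundary. -/
def halfspaceCutoff {m : ℕ} (k : ℕ) (v : Fin (m + 1) → ℝ) : ℝ :=
  max 0 (min 1 (min ((k + 1 : ℝ) * v 0 - 1) (k + 1 - ‖v‖)))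

theorem continuous_halfspaceCutoff {m : ℕ} (k : ℕ) :
    Continuous (halfspaceCutoff (m := m) k) := by
  unfold halfspaceCutoff
  fun_prop

theorem halfspaceCutoff_nonneg {m : ℕ} (k : ℕ) (v : Fin (m + 1) → ℝ) :
    0 ≤ halfspaceCutoff k v := le_max_left _ _

theorem halfspaceCutoff_eq_zero_of_norm {m k : ℕ} {v : Fin (m + 1) → ℝ} (hv : (k + 1 : ℝ) < ‖v‖) :
    halfspaceCutoff k v = 0 :=
  max_eq_left ((min_le_right _ _).trans ((min_le_right _ _).trans (by linarith)))

theorem halfspaceCutoff_eq_zero_of_lt {m k : ℕ} {v : Fin (m + 1) → ℝ}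
    (hv : v 0 < (k + 1 : ℝ)⁻¹) : halfspaceCutoff k v = 0 := by
  refine max_eq_left ((min_le_right _ _).trans ((min_le_left _ _).trans ?_))
  have hk : (0 : ℝ) < k + 1 := by positivity
  have := (lt_inv_mul_iff₀ hk).1 (by simpa using hv : v 0 < (k + 1 : ℝ)⁻¹ * 1)
  linarith

theorem halfspaceCutoff_mono {m : ℕ} {v : Fin (m + 1) → ℝ} (hv : 0 < v 0) :
    Monotone fun k => halfspaceCutoff k v := by
  intro k l hkl
  have : (k : ℝ) ≤ l := by exact_mod_cast hkl
  refine max_le_max_left _ (min_le_min_left _ (min_le_min ?_ ?_))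
  · nlinarith
  · linarith

theorem eventually_halfspaceCutoff_eq_one {m : ℕ} {v : Fin (m + 1) → ℝ} (hv : 0 < v 0) :
    ∀ᶠ k in atTop, halfspaceCutoff k v = 1 := by
  filter_upwards [tendsto_natCast_atTop_atTop.eventually_ge_atTop (2 / v 0),
    tendsto_natCast_atTop_atTop.eventually_ge_atTop ‖v‖] with k h1 h2
  rw [div_le_iff₀ hv] at h1
  have h3 : (1 : ℝ) ≤ min ((k + 1 : ℝ) * v 0 - 1) (k + 1 - ‖v‖) :=
    le_min (by nlinarith) (by linarith)
  rw [halfspaceCutoff, min_eq_left h3, max_eq_right zero_le_one]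

theorem siegelMeasure_withDensity_halfspaceCutoff {m : ℕ} (hm : 1 ≤ m)
    {μ : Measure (XSp (m + 1))} [IsProbabilityMeasure μ]
    (hμ : ∀ h : SLR (m + 1), MeasurePreserving (fun x : XSp (m + 1) => h • x) μ μ) (k : ℕ) :
    (siegelMeasure μ).withDensity (fun v => ENNReal.ofReal (halfspaceCutoff k v)) =
      volume.withDensity fun v => ENNReal.ofReal (halfspaceCutoff k v) := by
  have hχ : Continuous (halfspaceCutoff (m := m) k) := continuous_halfspaceCutoff k
  have hχm : Measurable fun v : Fin (m + 1) → ℝ => ENNReal.ofReal (halfspaceCutoff k v) :=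
    hχ.measurable.ennreal_ofReal
  have hχc : HasCompactSupport (halfspaceCutoff (m := m) k) :=
    HasCompactSupport.intro (isCompact_closedBall 0 (k + 1 : ℝ)) fun v hv =>
      halfspaceCutoff_eq_zero_of_norm (by simpa using hv)
  have := isFiniteMeasure_withDensity_ofReal
    (hχ.integrable_of_hasCompactSupport (μ := volume) hχc).hasFiniteIntegral
  symm
  refine ext_of_forall_lintegral_eq_of_IsFiniteMeasure fun b => ?_
  have hb : Measurable fun v => (b v : ENNReal) := b.continuous.measurable.coe_nnreal_ennreal
  rw [lintegral_withDensity_eq_lintegral_mul _ hχm hb,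
    lintegral_withDensity_eq_lintegral_mul _ hχm hb]
  have h := lintegral_siegelMeasure_of_continuous hm hμ (f := fun v => halfspaceCutoff k v * b v)
    (r := k + 1) (ε := (k + 1 : ℝ)⁻¹) (by positivity) (by positivity)
    (hχ.mul (NNReal.continuous_coe.comp b.continuous))
    (fun v => mul_nonneg (halfspaceCutoff_nonneg k v) (b v).2)
    (fun v hv => by rw [halfspaceCutoff_eq_zero_of_norm hv, zero_mul])
    (fun v hv => by rw [halfspaceCutoff_eq_zero_of_lt hv, zero_mul])
  simp only [ENNReal.ofReal_mul (halfspaceCutoff_nonneg k _), ENNReal.ofReal_coe_nnreal] at h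
  exact h.symm

theorem tendsto_withDensity_halfspaceCutoff {m : ℕ} (ν : Measure (Fin (m + 1) → ℝ))
    {s : Set (Fin (m + 1) → ℝ)} (hs : MeasurableSet s) (hsU : s ⊆ {v | 0 < v 0}) :
    Tendsto (fun k => ν.withDensity (fun v => ENNReal.ofReal (halfspaceCutoff k v)) s) atTop
      (𝓝 (ν s)) := by
  simp only [withDensity_apply _ hs]
  rw [← setLIntegral_one]
  refine lintegral_tendsto_of_tendsto_of_monotone
    (fun k => (continuous_halfspaceCutoff k).measurable.ennreal_ofReal.aemeasurable) ?_ ?_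
  · filter_upwards [ae_restrict_mem hs] with v hv k l hkl
    exact ENNReal.ofReal_le_ofReal (halfspaceCutoff_mono (hsU hv) hkl)
  · filter_upwards [ae_restrict_mem hs] with v hv
    refine tendsto_const_nhds.congr' ?_
    filter_upwards [eventually_halfspaceCutoff_eq_one (hsU hv)] with k hk
    rw [hk, ENNReal.ofReal_one]

theorem siegelMeasure_eq_volume {m : ℕ} (hm : 1 ≤ m) {μ : Measure (XSp (m + 1))}
    [IsProbabilityMeasure μ]
    (hμ : ∀ h : SLR (m + 1), MeasurePreserving (fun x : XSp (m + 1) => h • x) μ μ) :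
    siegelMeasure μ = volume := by
  refine siegelMeasure_eq_volume_of_halfspace hm hμ fun s hs hsU => ?_
  have h := tendsto_withDensity_halfspaceCutoff (siegelMeasure μ) hs hsU
  simp only [siegelMeasure_withDensity_halfspaceCutoff hm hμ] at h
  exact tendsto_nhds_unique h (tendsto_withDensity_halfspaceCutoff volume hs hsU)

/-- The Siegel mean value theorem: for `d ≥ 2` and a bounded, compactly supported,
Riemann-integrable `f` on `ℝ^d`, the Siegel transform `f̂` is in `L¹(X_d, μ)` and
`∫_{ℝ^d} f(v) dv = ∫_{X_d} f̂ dμ`, where `μ` is the `SL_d(ℝ)`-invariant Borel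
probability measure on `X_d`. -/
theorem siegel_mean_value (d : ℕ) (hd : 2 ≤ d)
    (f : (Fin d → ℝ) → ℝ)
    (hfb : ∃ C, ∀ v, |f v| ≤ C)
    (hfc : HasCompactSupport f)
    (hfr : volume {v | ¬ ContinuousAt f v} = 0)
    (μ : Measure (XSp d)) [IsProbabilityMeasure μ]
    (hμ : ∀ h : SLR d, MeasurePreserving (fun x : XSp d => h • x) μ μ) :
    Integrable (siegelX f) μ ∧ (∫ v, f v) = ∫ x, siegelX f x ∂μ := by
  obtain ⟨m, rfl⟩ : ∃ m, d = m + 1 := ⟨d - 1, by lia⟩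
  have hν : siegelMeasure μ = volume := siegelMeasure_eq_volume (by lia) hμ
  obtain ⟨C, hC⟩ := hfb
  have hfm : AEStronglyMeasurable f volume := aestronglyMeasurable_of_ae_continuousAt hfr
  have hfi : Integrable f volume := by
    rw [← integrableOn_iff_integrable_of_support_subset (subset_tsupport f)]
    exact Measure.integrableOn_of_bounded hfc.isCompact.measure_lt_top.ne hfm
      (ae_of_all _ hC)
  have h := integrable_siegelX_and_integral_eq hfc (hν.symm ▸ hfi)
  rwa [hν] at h
end
end

section
/- Let m ≥ 2, let S := {v ∈ ℝ^m : Π_{i=1}^m |v_i| ≤ 1}, let w be a point of S^{m-1} lying on a great sphere (i.e., w ∈ S^{m-1} with w_i = 0 for some i), and let A := B(w, ρ) ∩ S^{m-1} for some ρ > 0, where B(w, ρ) is the open Euclidean ball of radius ρ about w. Then the Lebesgue measure of 𝒞A ∩ S in ℝ^m is infinite, where 𝒞A denotes the union of all rays from the origin through points of A. -/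
open MeasureTheory Filter Topology Metric

noncomputable section

/-- The cone through a subset `A` of the unit sphere: the union of all rays from the
origin through points of `A`. -/
def coneOf {m : ℕ} (A : Set (EuclideanSpace ℝ (Fin m))) : Set (EuclideanSpace ℝ (Fin m)) :=
  {x | ∃ c : ℝ, 0 < c ∧ ∃ a ∈ A, x = c • a}

theorem coneOf_smul_mem {m : ℕ} {A : Set (EuclideanSpace ℝ (Fin m))} {r : ℝ} (hr : 0 < r)
    {x : EuclideanSpace ℝ (Fin m)} (hx : x ∈ coneOf A) : r • x ∈ coneOf A := by
  obtain ⟨c, hc, a, ha, rfl⟩ := hx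
  exact ⟨r * c, mul_pos hr hc, a, ha, smul_smul r c a⟩

/-- The cone through a spherical cap is a neighbourhood of every positive multiple of the
centre of the cap. -/
theorem coneOf_ball_inter_sphere_mem_nhds {m : ℕ} {w : EuclideanSpace ℝ (Fin m)}
    (hw : ‖w‖ = 1) {ρ c : ℝ} (hρ : 0 < ρ) (hc : 0 < c) :
    coneOf (ball w ρ ∩ sphere (0 : EuclideanSpace ℝ (Fin m)) 1) ∈ 𝓝 (c • w) := by
  have hne : c • w ≠ 0 := smul_ne_zero hc.ne' (by rintro rfl; simp at hw)
  have hcont : ContinuousAt (fun u : EuclideanSpace ℝ (Fin m) => ‖u‖⁻¹ • u) (c • w) :=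
    (continuousAt_id.norm.inv₀ (norm_ne_zero_iff.2 hne)).smul continuousAt_id
  have hval : ‖c • w‖⁻¹ • (c • w) = w := by
    rw [norm_smul, hw, Real.norm_of_nonneg hc.le, mul_one, inv_smul_smul₀ hc.ne']
  have hball : ball w ρ ∈ 𝓝 (‖c • w‖⁻¹ • (c • w)) := by
    rw [hval]; exact ball_mem_nhds w hρ
  filter_upwards [hcont hball, isOpen_ne.mem_nhds hne] with u hu hu0
  have hu0' : ‖u‖ ≠ 0 := norm_ne_zero_iff.2 hu0
  refine ⟨‖u‖, norm_pos_iff.2 hu0, ‖u‖⁻¹ • u, ⟨hu, ?_⟩, (smul_inv_smul₀ hu0' u).symm⟩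
  rw [mem_sphere_zero_iff_norm, norm_smul, norm_inv, norm_norm, inv_mul_cancel₀ hu0']

/-- The diagonal entries of a unimodular diagonal matrix which dilates all coordinates but
the one with index `i₀` by the factor `t`. -/
def squeeze {m : ℕ} (i₀ : Fin m) (t : ℝ) (i : Fin m) : ℝ :=
  if i = i₀ then (t ^ (m - 1))⁻¹ else t

theorem squeeze_pos {m : ℕ} (i₀ : Fin m) {t : ℝ} (ht : 0 < t) (i : Fin m) :
    0 < squeeze i₀ t i := by
  unfold squeeze; split_ifs <;> positivity

theorem squeeze_le {m : ℕ} (i₀ : Fin m) {t : ℝ} (ht : 1 ≤ t) (i : Fin m) :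
    squeeze i₀ t i ≤ t := by
  unfold squeeze
  split_ifs
  · exact (inv_le_one_of_one_le₀ (one_le_pow₀ ht)).trans ht
  · exact le_rfl

theorem prod_squeeze {m : ℕ} (i₀ : Fin m) {t : ℝ} (ht : 0 < t) :
    ∏ i, squeeze i₀ t i = 1 := by
  rw [← Finset.mul_prod_erase _ _ (Finset.mem_univ i₀),
    Finset.prod_congr rfl fun i hi => show squeeze i₀ t i = t from
      if_neg (Finset.ne_of_mem_erase hi)]
  simp [squeeze, ht.ne']

/-- The image of the cube of radius `δ` around `x` under the diagonal matrix with entries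
`squeeze i₀ t`. -/
def squeezedCube {m : ℕ} (i₀ : Fin m) (x : Fin m → ℝ) (δ t : ℝ) : Set (Fin m → ℝ) :=
  Set.univ.pi fun i =>
    Set.Ioo (squeeze i₀ t i * x i - squeeze i₀ t i * δ) (squeeze i₀ t i * x i + squeeze i₀ t i * δ)

theorem mem_squeezedCube {m : ℕ} {i₀ : Fin m} {x v : Fin m → ℝ} {δ t : ℝ} :
    v ∈ squeezedCube i₀ x δ t ↔
      ∀ i, |v i - squeeze i₀ t i * x i| < squeeze i₀ t i * δ := by
  simp only [squeezedCube, Set.mem_univ_pi, ← Real.ball_eq_Ioo, mem_ball, Real.dist_eq]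

theorem measurableSet_squeezedCube {m : ℕ} (i₀ : Fin m) (x : Fin m → ℝ) (δ t : ℝ) :
    MeasurableSet (squeezedCube i₀ x δ t) :=
  MeasurableSet.univ_pi fun _ => measurableSet_Ioo

theorem volume_squeezedCube {m : ℕ} (i₀ : Fin m) (x : Fin m → ℝ) {δ t : ℝ} (hδ : 0 < δ)
    (ht : 0 < t) : volume (squeezedCube i₀ x δ t) = ENNReal.ofReal ((2 * δ) ^ m) := by
  rw [squeezedCube, Real.volume_pi_Ioo, ← ENNReal.ofReal_prod_of_nonneg]
  · congr 1
    calc _ = ∏ i, squeeze i₀ t i * (2 * δ) := Finset.prod_congr rfl fun i _ => by ring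
      _ = _ := by simp [Finset.prod_mul_distrib, prod_squeeze i₀ ht]
  · intro i _
    have := mul_pos (squeeze_pos i₀ ht i) hδ
    linarith

/-- Squeezed cubes for dilation factors with ratio at least `2` are disjoint if the cube is
small compared with some coordinate of its centre. -/
theorem disjoint_squeezedCube {m : ℕ} {i₀ j : Fin m} (hj : j ≠ i₀) {x : Fin m → ℝ} {δ s t : ℝ}
    (hδ : 3 * δ ≤ |x j|) (hs : 0 < s) (hst : 2 * s ≤ t) (hδ0 : 0 < δ) :
    Disjoint (squeezedCube i₀ x δ s) (squeezedCube i₀ x δ t) := by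
  refine Set.disjoint_left.2 fun v hvs hvt => ?_
  have h1 := mem_squeezedCube.1 hvs j
  have h2 := mem_squeezedCube.1 hvt j
  simp only [squeeze, if_neg hj] at h1 h2
  have h3 := abs_sub_abs_le_abs_sub (v j) (s * x j)
  have h4 := abs_sub_abs_le_abs_sub (t * x j) (v j)
  rw [abs_sub_comm (t * x j)] at h4
  rw [abs_mul, abs_of_pos hs] at h3
  rw [abs_mul, abs_of_pos (show 0 < t by linarith)] at h4
  nlinarith [mul_le_mul_of_nonneg_right hst (show 0 ≤ |x j| - δ by linarith),
    mul_le_mul_of_nonneg_left hδ hs.le]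

theorem prod_abs_le_one_of_mem_squeezedCube {m : ℕ} {i₀ : Fin m} {x v : Fin m → ℝ} {δ t : ℝ}
    (ht : 0 < t) (hx : ∀ i, |x i| + δ ≤ 1) (hv : v ∈ squeezedCube i₀ x δ t) :
    ∏ i, |v i| ≤ 1 := by
  rw [← prod_squeeze i₀ ht]
  refine Finset.prod_le_prod (fun i _ => abs_nonneg _) fun i _ => ?_
  have h1 := mem_squeezedCube.1 hv i
  have h2 := abs_sub_abs_le_abs_sub (v i) (squeeze i₀ t i * x i)
  have hs := squeeze_pos i₀ ht i
  rw [abs_mul, abs_of_pos hs] at h2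
  nlinarith [mul_le_mul_of_nonneg_left (hx i) hs.le]

theorem dist_inv_smul_lt_of_mem_squeezedCube {m : ℕ} {i₀ : Fin m} {x v : Fin m → ℝ} {δ t : ℝ}
    (hδ : 0 < δ) (ht : 1 ≤ t) (hx : x i₀ = 0) (hv : v ∈ squeezedCube i₀ x δ t) :
    dist (t⁻¹ • v) x < δ := by
  have ht0 : 0 < t := by linarith
  refine (dist_pi_lt_iff hδ).2 fun i => ?_
  have h1 := mem_squeezedCube.1 hv i
  have h2 : |v i - t * x i| < t * δ := by
    by_cases hi : i = i₀
    · subst hi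
      rw [hx, mul_zero, sub_zero] at h1 ⊢
      exact h1.trans_le (mul_le_mul_of_nonneg_right (squeeze_le i ht i) hδ.le)
    · simpa [squeeze, hi] using h1
  have h3 : (t⁻¹ • v) i - x i = t⁻¹ * (v i - t * x i) := by
    simp only [Pi.smul_apply, smul_eq_mul]; field_simp
  rw [Real.dist_eq, h3, abs_mul, abs_of_pos (inv_pos.2 ht0), inv_mul_lt_iff₀ ht0]
  exact h2

/-- Let `m ≥ 2`, let `S = {v ∈ ℝ^m : ∏ i |v_i| ≤ 1}`, let `w` be a point of `S^{m-1}`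
lying on a great sphere (`w_{i₀} = 0` for some `i₀`), and let `A = B(w, ρ) ∩ S^{m-1}`
for some `ρ > 0`.  Then the Lebesgue measure of `𝒞A ∩ S` in `ℝ^m` is infinite. -/
theorem cone_star_body_infinite_volume (m : ℕ) (hm : 2 ≤ m)
    (w : EuclideanSpace ℝ (Fin m))
    (hw : w ∈ Metric.sphere (0 : EuclideanSpace ℝ (Fin m)) 1)
    (i₀ : Fin m) (hwi₀ : w i₀ = 0)
    (ρ : ℝ) (hρ : 0 < ρ) :
    volume (coneOf (Metric.ball w ρ ∩ Metric.sphere (0 : EuclideanSpace ℝ (Fin m)) 1) ∩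
      {v : EuclideanSpace ℝ (Fin m) | ∏ i, |v i| ≤ 1}) = ⊤ := by
  have hw1 : ‖w‖ = 1 := mem_sphere_zero_iff_norm.1 hw
  set A := Metric.ball w ρ ∩ Metric.sphere (0 : EuclideanSpace ℝ (Fin m)) 1
  obtain ⟨j, hwj⟩ : ∃ j, w j ≠ 0 := by
    by_contra! h
    have : w = 0 := by ext i; simpa using h i
    simp [this] at hw1
  have hj : j ≠ i₀ := by rintro rfl; exact hwj hwi₀
  let x : Fin m → ℝ := fun i => (1 / 2) * w i
  have hcone : WithLp.toLp 2 ⁻¹' coneOf A ∈ 𝓝 x :=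
    (PiLp.continuous_toLp 2 (fun _ : Fin m => ℝ)).continuousAt
      (coneOf_ball_inter_sphere_mem_nhds (c := 1 / 2) hw1 hρ (by norm_num))
  obtain ⟨ε, hε, hball⟩ := Metric.mem_nhds_iff.1 hcone
  have hxj : 0 < |x j| := abs_pos.2 (mul_ne_zero (by norm_num) hwj)
  have hx : ∀ i, |x i| ≤ 1 / 2 := fun i => by
    have h := PiLp.norm_apply_le w i
    rw [hw1, Real.norm_eq_abs] at h
    rw [abs_mul, abs_of_pos (by norm_num : (0 : ℝ) < 1 / 2)]
    linarith
  obtain ⟨δ, hδ, hδε, hδj, hδ1⟩ : ∃ δ : ℝ, 0 < δ ∧ δ ≤ ε ∧ 3 * δ ≤ |x j| ∧ δ ≤ 1 / 2 := by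
    have h1 := min_le_left ε (|x j| / 3)
    have h2 := min_le_right ε (|x j| / 3)
    have h3 := hx j
    exact ⟨min ε (|x j| / 3), lt_min hε (by linarith), h1, by linarith, by linarith⟩
  have hsub : (⋃ n : ℕ, squeezedCube i₀ x δ (2 ^ n)) ⊆ WithLp.toLp 2 ⁻¹'
      (coneOf A ∩ {v : EuclideanSpace ℝ (Fin m) | ∏ i, |v i| ≤ 1}) := by
    refine Set.iUnion_subset fun n v hv => ⟨?_, ?_⟩
    · have hd := dist_inv_smul_lt_of_mem_squeezedCube hδ
        (one_le_pow₀ (by norm_num : (1 : ℝ) ≤ 2)) (by simp [x, hwi₀]) hv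
      have hmem := coneOf_smul_mem (r := 2 ^ n) (by positivity) (hball (hd.trans_le hδε))
      rwa [← WithLp.toLp_smul, smul_inv_smul₀ (by positivity)] at hmem
    · exact prod_abs_le_one_of_mem_squeezedCube (t := 2 ^ n) (by positivity)
        (fun i => by linarith [hx i]) hv
  have hdisj : Pairwise (Function.onFun Disjoint fun n : ℕ => squeezedCube i₀ x δ (2 ^ n)) := by
    refine (pairwise_disjoint_on _).2 fun a b hab => ?_
    refine disjoint_squeezedCube hj hδj (by positivity) ?_ hδ
    rw [← pow_succ']
    exact pow_le_pow_right₀ (by norm_num) hab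
  have hvol : volume (⋃ n : ℕ, squeezedCube i₀ x δ (2 ^ n)) = ⊤ := by
    rw [measure_iUnion hdisj fun n => measurableSet_squeezedCube _ _ _ _]
    simp_rw [fun n : ℕ => volume_squeezedCube i₀ x hδ (show (0 : ℝ) < 2 ^ n by positivity)]
    exact ENNReal.tsum_const_eq_top_of_ne_zero (ENNReal.ofReal_pos.2 (by positivity)).ne'
  have hpre := (PiLp.volume_preserving_toLp (Fin m)).measure_preimage_equiv
    (f := MeasurableEquiv.toLp 2 (Fin m → ℝ))
    (coneOf A ∩ {v : EuclideanSpace ℝ (Fin m) | ∏ i, |v i| ≤ 1})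
  rw [← hpre, eq_top_iff, ← hvol]
  exact measure_mono hsub
end
end

section
/- (Dirichlet's theorem for systems of linear forms) Let m, n ≥ 1, let α_{ij} (1 ≤ i ≤ n, 1 ≤ j ≤ m) be real numbers, and let Q > 1 be an integer. Then there exist integers q₁, …, q_m, p₁, …, p_n such that 1 ≤ max{|q₁|, …, |q_m|} ≤ Q and max_{1 ≤ i ≤ n} |α_{i1}q₁ + ⋯ + α_{im}q_m − p_i| ≤ Q^{-m/n}. -/
open MeasureTheory

/-- Minkowski's convex body theorem for the lattice `ℤ^ι` in `ℝ^ι`. -/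
theorem exists_ne_zero_int_mem_of_two_pow_le_volume {ι : Type*} [Fintype ι] [Nonempty ι]
    (s : Set (ι → ℝ)) (h_symm : ∀ x ∈ s, -x ∈ s) (h_conv : Convex ℝ s) (h_cpt : IsCompact s)
    (h : 2 ^ Fintype.card ι ≤ volume s) :
    ∃ z : ι → ℤ, z ≠ 0 ∧ (fun i => (z i : ℝ)) ∈ s := by
  classical
  let b := Pi.basisFun ℝ ι
  have fund := ZSpan.isAddFundamentalDomain' b volume
  have hvol : volume (ZSpan.fundamentalDomain b) = 1 := by
    rw [ZSpan.fundamentalDomain_pi_basisFun, volume_pi_pi]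
    simp
  have : Countable (Submodule.span ℤ (Set.range b)).toAddSubgroup :=
    inferInstanceAs (Countable (Submodule.span ℤ (Set.range b)))
  have : DiscreteTopology (Submodule.span ℤ (Set.range b)).toAddSubgroup :=
    inferInstanceAs (DiscreteTopology (Submodule.span ℤ (Set.range b)))
  obtain ⟨⟨x, hxL⟩, hx0, hxs⟩ :=
    exists_ne_zero_mem_lattice_of_measure_mul_two_pow_le_measure fund h_symm h_conv h_cpt
      (by simpa [hvol] using h)
  have hxL' := (b.mem_span_iff_repr_mem ℤ x).1 hxL
  choose z hz using hxL'
  have hzx : (fun i => (z i : ℝ)) = x := by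
    funext i
    simpa [b] using hz i
  refine ⟨z, ?_, hzx ▸ hxs⟩
  rintro rfl
  exact hx0 (Subtype.ext (by simpa [funext_iff, eq_comm] using hzx))

/-- The volume of the product of an `m`-cube of half-side `A` and an `n`-cube of half-side `B` in
`ℝ^(m + n)`. -/
theorem volume_pi_sumElim_Icc (m n : ℕ) {A B : ℝ} (hA : 0 ≤ A) (hB : 0 ≤ B) :
    volume (Set.univ.pi fun k : Fin m ⊕ Fin n =>
      Set.Icc (-(Sum.elim (fun _ => A) (fun _ => B) k : ℝ))
        (Sum.elim (fun _ => A) (fun _ => B) k)) =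
      ENNReal.ofReal (2 ^ (m + n) * (A ^ m * B ^ n)) := by
  rw [volume_pi_pi, Fintype.prod_sum_type]
  simp only [Sum.elim_inl, Sum.elim_inr, Real.volume_Icc, Finset.prod_const, Finset.card_univ,
    Fintype.card_fin]
  rw [← ENNReal.ofReal_pow (by linarith), ← ENNReal.ofReal_pow (by linarith),
    ← ENNReal.ofReal_mul (pow_nonneg (by linarith) _)]
  congr 1
  ring

/-- Minkowski's theorem for the forms `q_j` and `α q - p`. -/
theorem exists_ne_zero_int_abs_linear_forms_le (m n : ℕ) (hm : 1 ≤ m)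
    (α : Matrix (Fin n) (Fin m) ℝ) {A B : ℝ} (hA : 0 ≤ A) (hB : 0 ≤ B)
    (hAB : 1 ≤ A ^ m * B ^ n) :
    ∃ q : Fin m → ℤ, ∃ p : Fin n → ℤ, (q ≠ 0 ∨ p ≠ 0) ∧ (∀ j, |(q j : ℝ)| ≤ A) ∧
      ∀ i, |∑ j, α i j * (q j : ℝ) - (p i : ℝ)| ≤ B := by
  have : Nonempty (Fin m ⊕ Fin n) := ⟨Sum.inl ⟨0, hm⟩⟩
  let M : Matrix (Fin m ⊕ Fin n) (Fin m ⊕ Fin n) ℝ := Matrix.fromBlocks 1 0 α (-1)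
  have hMM : M * M = 1 := by
    simp [M, Matrix.fromBlocks_multiply, ← Matrix.fromBlocks_one]
  have hdet : |M.det| = 1 := by
    have h := congrArg Matrix.det hMM
    rw [Matrix.det_mul, Matrix.det_one] at h
    rcases mul_self_eq_one_iff.1 h with h | h <;> simp [h]
  let c : Fin m ⊕ Fin n → ℝ := Sum.elim (fun _ => A) (fun _ => B)
  let box : Set (Fin m ⊕ Fin n → ℝ) := Set.univ.pi fun k => Set.Icc (-c k) (c k)
  obtain ⟨z, hz0, y, hy, hyz⟩ := exists_ne_zero_int_mem_of_two_pow_le_volume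
    (Matrix.toLin' M '' box)
    (by
      rintro _ ⟨y, hy, rfl⟩
      refine ⟨-y, fun k hk => ?_, map_neg _ _⟩
      have := hy k hk
      simp only [Set.mem_Icc, Pi.neg_apply] at this ⊢
      constructor <;> linarith)
    ((convex_pi fun k _ => convex_Icc _ _).linear_image _)
    ((isCompact_univ_pi fun k => isCompact_Icc).image
      (LinearMap.continuous_of_finiteDimensional _))
    (by
      rw [Measure.addHaar_image_linearMap, LinearMap.det_toLin', hdet,
        volume_pi_sumElim_Icc m n hA hB, ENNReal.ofReal_one, one_mul, Fintype.card_sum,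
        Fintype.card_fin, Fintype.card_fin, ENNReal.le_ofReal_iff_toReal_le (by simp)
        (by positivity)]
      simpa using hAB)
  have hy' : M.mulVec (fun k => (z k : ℝ)) = y := by
    rw [← hyz, Matrix.toLin'_apply, Matrix.mulVec_mulVec, hMM, Matrix.one_mulVec]
  have hbound : ∀ k, |M.mulVec (fun k => (z k : ℝ)) k| ≤ c k := fun k =>
    abs_le.2 (hy' ▸ hy k (Set.mem_univ k))
  refine ⟨fun j => z (Sum.inl j), fun i => z (Sum.inr i), ?_, fun j => ?_, fun i => ?_⟩
  · by_contra! h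
    refine hz0 (funext ?_)
    rintro (j | i)
    · exact congrFun h.1 j
    · exact congrFun h.2 i
  · simpa [M, c, Matrix.fromBlocks_mulVec, Function.comp_def] using hbound (Sum.inl j)
  · simpa [M, c, Matrix.fromBlocks_mulVec, Function.comp_def, Matrix.neg_mulVec, Matrix.mulVec,
      dotProduct, sub_eq_add_neg, Matrix.one_apply] using hbound (Sum.inr i)

/-- Dirichlet's theorem for systems of linear forms: given an `n × m` real matrix `α`
and an integer `Q > 1`, there are integers `q₁, …, q_m`, `p₁, …, p_n` with
`1 ≤ max_j |q_j| ≤ Q` and `max_i |α_{i1} q₁ + ⋯ + α_{im} q_m − p_i| ≤ Q^{−m/n}`. -/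
theorem dirichlet_linear_forms (m n : ℕ) (hm : 1 ≤ m) (hn : 1 ≤ n)
    (α : Matrix (Fin n) (Fin m) ℝ) (Q : ℤ) (hQ : 1 < Q) :
    ∃ q : Fin m → ℤ, ∃ p : Fin n → ℤ,
      (∃ j, 1 ≤ |q j|) ∧ (∀ j, |q j| ≤ Q) ∧
      ∀ i, |∑ j, α i j * (q j : ℝ) - (p i : ℝ)| ≤ (Q : ℝ) ^ (-(m : ℝ) / (n : ℝ)) := by
  have hQ1 : (1 : ℝ) < Q := by exact_mod_cast hQ
  have hQ0 : (0 : ℝ) < Q := by linarith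
  have hm0 : (0 : ℝ) < m := by exact_mod_cast hm
  have hn0 : (0 : ℝ) < n := by exact_mod_cast hn
  have hprod : (Q : ℝ) ^ m * ((Q : ℝ) ^ (-(m : ℝ) / (n : ℝ))) ^ n = 1 := by
    rw [← Real.rpow_mul_natCast hQ0.le, div_mul_cancel₀ _ hn0.ne', Real.rpow_neg hQ0.le,
      Real.rpow_natCast, mul_inv_cancel₀ (by positivity)]
  have hlt : (Q : ℝ) ^ (-(m : ℝ) / (n : ℝ)) < 1 :=
    Real.rpow_lt_one_of_one_lt_of_neg hQ1 (div_neg_of_neg_of_pos (neg_neg_of_pos hm0) hn0)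
  obtain ⟨q, p, hqp, hq, hp⟩ := exists_ne_zero_int_abs_linear_forms_le m n hm α hQ0.le
    (Real.rpow_nonneg hQ0.le _) hprod.ge
  refine ⟨q, p, ?_, fun j => by exact_mod_cast hq j, hp⟩
  have hq0 : q ≠ 0 := by
    rintro rfl
    refine hqp.elim (fun h => h rfl) fun h => h (funext fun i => ?_)
    have hi : |(p i : ℝ)| < 1 := by simpa using (hp i).trans_lt hlt
    exact Int.abs_lt_one_iff.1 (by exact_mod_cast hi)
  obtain ⟨j, hj⟩ := Function.ne_iff.1 hq0
  exact ⟨j, Int.one_le_abs hj⟩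
end

section
/- (Weighted Dirichlet theorem) Let m, n ≥ 1, let α_{ij} (1 ≤ i ≤ n, 1 ≤ j ≤ m) be real numbers, and let r = (r₁, …, r_n) ∈ ℝ^n and s = (s₁, …, s_m) ∈ ℝ^m be probability vectors with all entries positive. Then there exist infinitely many integer vectors (q₁, …, q_m) ∈ ℤ^m with q ≠ 0 such that max_{1 ≤ i ≤ n} |α_{i1}q₁ + ⋯ + α_{im}q_m − p_i|^{1/r_i} ≤ (max_{1 ≤ j ≤ m} |q_j|^{1/s_j})^{-1} for some integers p₁, …, p_n. -/
open MeasureTheory in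
/-- **Minkowski's linear forms theorem**: an invertible system of linear forms whose determinant is
bounded by `∏ i, c i` has a nonzero integer vector at which the `i`-th form is at most `c i`. -/
theorem exists_int_ne_zero_abs_mulVec_le {ι : Type*} [Fintype ι] [DecidableEq ι] [Nonempty ι]
    (M : Matrix ι ι ℝ) (hM : IsUnit M) (c : ι → ℝ) (hc : ∀ i, 0 ≤ c i)
    (hdet : |M.det| ≤ ∏ i, c i) :
    ∃ z : ι → ℤ, z ≠ 0 ∧ ∀ i, |M.mulVec (fun k => (z k : ℝ)) i| ≤ c i := by
  classical
  have hli : LinearIndependent ℝ M.transpose.row :=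
    Matrix.linearIndependent_rows_iff_isUnit.2 (M.isUnit_transpose.2 hM)
  let b : Module.Basis ι ℝ (ι → ℝ) := basisOfPiSpaceOfLinearIndependent hli
  have hb : (b : ι → ι → ℝ) = M.transpose.row := coe_basisOfPiSpaceOfLinearIndependent hli
  have h_fund := ZSpan.isAddFundamentalDomain' b volume
  have : Countable (Submodule.span ℤ (Set.range b)).toAddSubgroup := by
    change Countable (Submodule.span ℤ (Set.range b))
    infer_instance
  have hvol : volume (ZSpan.fundamentalDomain b) * 2 ^ Module.finrank ℝ (ι → ℝ) ≤
      volume (Set.Icc (-c) c) := by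
    have hof : Matrix.of (b : ι → ι → ℝ) = M.transpose := hb
    have hcc : ∀ i, c i - (-c) i = c i * 2 := fun i => by simp [mul_two]
    simp_rw [ZSpan.volume_fundamentalDomain, hof, Matrix.det_transpose, Real.volume_Icc_pi, hcc]
    rw [← ENNReal.ofReal_prod_of_nonneg fun i _ => mul_nonneg (hc i) zero_le_two,
      Finset.prod_mul_distrib, ENNReal.ofReal_mul (Finset.prod_nonneg fun i _ => hc i)]
    simp only [Module.finrank_fintype_fun_eq_card, Finset.prod_const, Finset.card_univ]
    rw [ENNReal.ofReal_pow zero_le_two, ENNReal.ofReal_ofNat]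
    gcongr
  obtain ⟨⟨x, hx⟩, hx0, hxc⟩ := exists_ne_zero_mem_lattice_of_measure_mul_two_pow_le_measure h_fund
    (fun x (hx : x ∈ Set.Icc (-c) c) => ⟨neg_le_neg hx.2, neg_le.2 hx.1⟩)
    (convex_Icc (-c) c) isCompact_Icc hvol
  obtain ⟨z, rfl⟩ := (Submodule.mem_span_range_iff_exists_fun ℤ).1 hx
  have hz : ∀ i, M.mulVec (fun k => (z k : ℝ)) i = (∑ k, z k • b k) i := fun i => by
    simp [hb, Matrix.mulVec, dotProduct, Matrix.row, mul_comm]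
  refine ⟨z, ?_, fun i => ?_⟩
  · rintro rfl
    simp at hx0
  · rw [hz, abs_le]
    exact ⟨hxc.1 i, hxc.2 i⟩

/-- The weighted Dirichlet theorem with a prescribed bound `T` on the size of `q`. -/
theorem exists_int_ne_zero_weighted_le {κ ι : Type*} [Fintype κ] [Fintype ι]
    (α : Matrix κ ι ℝ) (r : κ → ℝ) (hrpos : ∀ i, 0 < r i) (hrsum : ∑ i, r i = 1)
    (s : ι → ℝ) (hspos : ∀ j, 0 < s j) (hssum : ∑ j, s j = 1) {T : ℝ} (hT : 1 < T) :
    ∃ (q : ι → ℤ) (p : κ → ℤ), q ≠ 0 ∧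
      (∀ i, |∑ j, α i j * (q j : ℝ) - (p i : ℝ)| ^ (r i)⁻¹ ≤ T⁻¹) ∧
      ∀ j, |(q j : ℝ)| ^ (s j)⁻¹ ≤ T := by
  classical
  have hT0 : 0 < T := zero_lt_one.trans hT
  have : Nonempty ι := by
    by_contra h
    simp [not_nonempty_iff.1 h] at hssum
  let M : Matrix (κ ⊕ ι) (κ ⊕ ι) ℝ := Matrix.fromBlocks 1 α 0 1
  have hdet : M.det = 1 := by simp [M]
  obtain ⟨z, hz0, hz⟩ := exists_int_ne_zero_abs_mulVec_le M
    ((Matrix.isUnit_iff_isUnit_det M).2 (by simp [hdet]))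
    (Sum.elim (fun i => T⁻¹ ^ r i) (fun j => T ^ s j))
    (by rintro (i | j) <;> simp <;> positivity)
    (by
      rw [hdet, Fintype.prod_sum_type]
      simp only [Sum.elim_inl, Sum.elim_inr]
      rw [← Real.rpow_sum_of_pos (inv_pos.2 hT0), ← Real.rpow_sum_of_pos hT0, hrsum, hssum]
      simp [hT0.ne'])
  have hp : ∀ i, |∑ j, α i j * (z (.inr j) : ℝ) - ((-z (.inl i) : ℤ) : ℝ)| ≤ T⁻¹ ^ r i := by
    intro i
    have := hz (.inl i)
    simpa [M, Matrix.mulVec, dotProduct, Matrix.one_apply, add_comm] using this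
  have hq : ∀ j, |(z (.inr j) : ℝ)| ≤ T ^ s j := by
    intro j
    have := hz (.inr j)
    simpa [M, Matrix.mulVec, dotProduct, Matrix.one_apply] using this
  refine ⟨fun j => z (.inr j), fun i => -z (.inl i), fun h => hz0 ?_, fun i => ?_, fun j => ?_⟩
  · have hzq : ∀ j, z (.inr j) = 0 := congrFun h
    ext (i | j)
    · have hlt : |((-z (.inl i) : ℤ) : ℝ)| < 1 := by
        have := (hp i).trans_lt
          (Real.rpow_lt_one (inv_pos.2 hT0).le (inv_lt_one_of_one_lt₀ hT) (hrpos i))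
        simpa [hzq] using this
      have : |-z (.inl i)| < 1 := by exact_mod_cast hlt
      simpa using Int.abs_lt_one_iff.1 this
    · exact hzq j
  · exact (Real.rpow_inv_le_iff_of_pos (abs_nonneg _) (inv_pos.2 hT0).le (hrpos i)).2 (hp i)
  · exact (Real.rpow_inv_le_iff_of_pos (abs_nonneg _) hT0.le (hspos j)).2 (hq j)

/-- The weighted Dirichlet theorem: given an `n × m` real matrix `α` and probability
vectors `r ∈ ℝ^n`, `s ∈ ℝ^m` with positive entries, there are infinitely many nonzero
integer vectors `q = (q₁, …, q_m)` such that
`max_i |α_{i1} q₁ + ⋯ + α_{im} q_m − p_i|^{1/r_i} ≤ (max_j |q_j|^{1/s_j})⁻¹`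
for some integers `p₁, …, p_n`. -/
theorem weighted_dirichlet (m n : ℕ) (hm : 1 ≤ m) (hn : 1 ≤ n)
    (α : Matrix (Fin n) (Fin m) ℝ)
    (r : Fin n → ℝ) (hrpos : ∀ i, 0 < r i) (hrsum : ∑ i, r i = 1)
    (s : Fin m → ℝ) (hspos : ∀ j, 0 < s j) (hssum : ∑ j, s j = 1) :
    {q : Fin m → ℤ | q ≠ 0 ∧ ∃ p : Fin n → ℤ,
      ∀ i, |∑ j, α i j * (q j : ℝ) - (p i : ℝ)| ^ (r i)⁻¹ ≤
        (⨆ j, |(q j : ℝ)| ^ (s j)⁻¹)⁻¹}.Infinite := by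
  have : Nonempty (Fin m) := ⟨⟨0, hm⟩⟩
  intro hfin
  have hex : ∀ k : ℕ, ∃ q : Fin m → ℤ, ∃ p : Fin n → ℤ, q ≠ 0 ∧
      (∀ i, |∑ j, α i j * (q j : ℝ) - (p i : ℝ)| ^ (r i)⁻¹ ≤ ((k : ℝ) + 2)⁻¹) ∧
      ∀ j, |(q j : ℝ)| ^ (s j)⁻¹ ≤ (k : ℝ) + 2 := fun k =>
    exists_int_ne_zero_weighted_le α r hrpos hrsum s hspos hssum
      (by have := k.cast_nonneg (α := ℝ); linarith)
  choose q p hq0 hqp hqT using hex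
  have hmem : ∀ k, q k ∈ {q : Fin m → ℤ | q ≠ 0 ∧ ∃ p : Fin n → ℤ,
      ∀ i, |∑ j, α i j * (q j : ℝ) - (p i : ℝ)| ^ (r i)⁻¹ ≤
        (⨆ j, |(q j : ℝ)| ^ (s j)⁻¹)⁻¹} := by
    refine fun k => ⟨hq0 k, p k, fun i => (hqp k i).trans (inv_anti₀ ?_ (ciSup_le (hqT k)))⟩
    obtain ⟨j, hj⟩ := Function.ne_iff.1 (hq0 k)
    have hj' : (q k j : ℝ) ≠ 0 := Int.cast_ne_zero.2 hj
    exact (Real.rpow_pos_of_pos (abs_pos.2 hj') _).trans_le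
      (le_ciSup (f := fun j => |(q k j : ℝ)| ^ (s j)⁻¹) (Set.finite_range _).bddAbove j)
  -- A single `q₀` is attained for infinitely many bounds, so all its forms are integral.
  obtain ⟨q₀, hq₀⟩ : ∃ q₀, (q ⁻¹' {q₀}).Infinite := by
    by_contra! h
    refine Set.infinite_univ (α := ℕ) ((hfin.preimage' fun b _ => h b).subset fun k _ => hmem k)
  have hround : ∀ i, ∑ j, α i j * (q₀ j : ℝ) = round (∑ j, α i j * (q₀ j : ℝ)) := by
    intro i
    set x := ∑ j, α i j * (q₀ j : ℝ) with hx
    by_contra hne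
    have hpos : 0 < |x - round x| ^ (r i)⁻¹ :=
      Real.rpow_pos_of_pos (abs_pos.2 (sub_ne_zero.2 hne)) _
    obtain ⟨N, hN⟩ := exists_nat_gt (|x - round x| ^ (r i)⁻¹)⁻¹
    obtain ⟨k, hk, hNk⟩ := hq₀.exists_gt N
    have hk : q k = q₀ := hk
    have h1 : |x - round x| ^ (r i)⁻¹ ≤ ((k : ℝ) + 2)⁻¹ := by
      refine le_trans (Real.rpow_le_rpow (abs_nonneg _) (round_le x (p k i))
        (inv_nonneg.2 (hrpos i).le)) ?_
      rw [hx, ← hk]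
      exact hqp k i
    have h2 := (le_inv_comm₀ hpos (by positivity)).1 h1
    have h3 : (N : ℝ) < k := by exact_mod_cast hNk
    linarith
  have hq₀0 : q₀ ≠ 0 := by
    obtain ⟨k, hk⟩ := hq₀.nonempty
    exact (show q k = q₀ from hk) ▸ hq0 k
  refine Set.infinite_of_injective_forall_mem (f := fun N : ℕ => (N + 1 : ℤ) • q₀) ?_ ?_ hfin
  · intro a b hab
    have := smul_left_injective ℤ hq₀0 hab
    lia
  · refine fun N => ⟨smul_ne_zero (by lia) hq₀0,
      fun i => (N + 1) * round (∑ j, α i j * (q₀ j : ℝ)), fun i => ?_⟩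
    have hzero : ∑ j, α i j * ((((N + 1 : ℤ) • q₀) j : ℤ) : ℝ) -
        (((N + 1) * round (∑ j, α i j * (q₀ j : ℝ)) : ℤ) : ℝ) = 0 := by
      push_cast
      rw [← hround i, Finset.mul_sum, ← Finset.sum_sub_distrib]
      refine Finset.sum_eq_zero fun j _ => ?_
      simp
      ring
    rw [hzero, abs_zero, Real.zero_rpow (inv_ne_zero (hrpos i).ne')]
    exact inv_nonneg.2 (Real.iSup_nonneg fun j => by positivity)
end
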